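/- arXiv:1002.1772 — 2 statements merged into one kernel-verified Lean document; each statement's English description precedes it below -/
import Mathlib

section
/- Let n ≥ 2, δ > 0, and let m ≥ 1 be an integer. There exists a constant A > 0 (independent of k) such that for every integer k ≥ m and every u ∈ H^k(B⁺_{1+δ}) vanishing on the flat boundary part Γ_{1+δ}: (1/k!) |u|_{H^k(B⁺_1)} ≤ A^{k+1} ( Σ_{ℓ=m−1}^{k−2} (1/ℓ!) |Δu|_{H^ℓ(B⁺_{1+δ})} + |u|_{H^m(B⁺_{1+δ})} ), the sum over ℓ being empty when k < m+1. -/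
open MeasureTheory Finset Real

noncomputable section

variable {n : ℕ}

/-- Partial derivative in the `i`-th coordinate direction of `ℝⁿ`. -/
def pdN (i : Fin n) (u : EuclideanSpace ℝ (Fin n) → ℝ) : EuclideanSpace ℝ (Fin n) → ℝ :=
  fun x => fderiv ℝ u x (EuclideanSpace.single i 1)

/-- Multi-index derivative `∂^α`. -/
def mdN (α : Fin n → ℕ) (u : EuclideanSpace ℝ (Fin n) → ℝ) : EuclideanSpace ℝ (Fin n) → ℝ :=
  (List.finRange n).foldr (fun i v => (pdN i)^[α i] v) u

/-- The Laplacian on `ℝⁿ`. -/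
def lapN (u : EuclideanSpace ℝ (Fin n) → ℝ) : EuclideanSpace ℝ (Fin n) → ℝ :=
  fun x => ∑ i : Fin n, pdN i (pdN i u) x

/-- Sobolev seminorm `|v|_{H^ℓ(V)} = (∑_{|α|=ℓ} ‖∂^α v‖²_{L²(V)})^{1/2}`. -/
def hSemi (ℓ : ℕ) (V : Set (EuclideanSpace ℝ (Fin n))) (u : EuclideanSpace ℝ (Fin n) → ℝ) : ℝ :=
  Real.sqrt (∑ α ∈ Finset.Nat.antidiagonalTuple n ℓ, ∫ x in V, (mdN α u x) ^ 2)

/-- Membership `u ∈ H^k(V)`: all derivatives up to order `k` are square integrable. -/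
def MemHk (k : ℕ) (V : Set (EuclideanSpace ℝ (Fin n))) (u : EuclideanSpace ℝ (Fin n) → ℝ) :
    Prop :=
  ∀ ℓ ≤ k, ∀ α ∈ Finset.Nat.antidiagonalTuple n ℓ,
    IntegrableOn (fun x => (mdN α u x) ^ 2) V

/-- The open half-ball `B⁺_ρ = {x : |x| < ρ, x_n > 0}`. -/
def halfBall (n : ℕ) (hn : 0 < n) (ρ : ℝ) : Set (EuclideanSpace ℝ (Fin n)) :=
  {x | ‖x‖ < ρ ∧ 0 < x ⟨n - 1, Nat.sub_lt hn one_pos⟩}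

/-- The flat part `Γ_ρ = {x : |x| < ρ, x_n = 0}` of the boundary of the half-ball. -/
def flatPart (n : ℕ) (hn : 0 < n) (ρ : ℝ) : Set (EuclideanSpace ℝ (Fin n)) :=
  {x | ‖x‖ < ρ ∧ x ⟨n - 1, Nat.sub_lt hn one_pos⟩ = 0}

section HalfSpace

/-- The Euclidean space `ℝⁿ`. -/
abbrev Eu (n : ℕ) := EuclideanSpace ℝ (Fin n)

/-- The open half-space `{x_ν > 0}`. -/
def upperHalf (ν : Fin n) : Set (Eu n) := {x | 0 < x ν}

/-- The closed half-space `{x_ν ≥ 0}`. -/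
def closedUpperHalf (ν : Fin n) : Set (Eu n) := {x | 0 ≤ x ν}

lemma isOpen_upperHalf (ν : Fin n) : IsOpen (upperHalf ν) :=
  isOpen_lt continuous_const (by fun_prop)

lemma isClosed_closedUpperHalf (ν : Fin n) : IsClosed (closedUpperHalf ν) :=
  isClosed_le continuous_const (by fun_prop)

lemma upperHalf_subset (ν : Fin n) : upperHalf ν ⊆ closedUpperHalf ν := fun x (hx : 0 < x ν) => hx.le

lemma measurableSet_upperHalf (ν : Fin n) : MeasurableSet (upperHalf ν) :=
  (isOpen_upperHalf ν).measurableSet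

lemma closedUpperHalf_mem_nhds {ν : Fin n} {x : Eu n} (hx : x ∈ upperHalf ν) :
    closedUpperHalf ν ∈ nhds x :=
  Filter.mem_of_superset ((isOpen_upperHalf ν).mem_nhds hx) (upperHalf_subset ν)

lemma uniqueDiffOn_closedUpperHalf (ν : Fin n) : UniqueDiffOn ℝ (closedUpperHalf ν) := by
  refine uniqueDiffOn_convex ?_ ?_
  · intro x hx y hy a b ha hb _
    simp only [closedUpperHalf, Set.mem_ofPred_eq, PiLp.add_apply, PiLp.smul_apply,
      smul_eq_mul] at *
    positivity
  · refine ⟨EuclideanSpace.single ν 1, ?_⟩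
    rw [mem_interior_iff_mem_nhds]
    exact closedUpperHalf_mem_nhds (by simp [upperHalf])

lemma differentiableAt_of_mem_upperHalf {ν : Fin n} {P : Eu n → ℝ}
    (hP : ContDiffOn ℝ 1 P (closedUpperHalf ν)) {x : Eu n} (hx : x ∈ upperHalf ν) :
    DifferentiableAt ℝ P x :=
  (hP.contDiffAt (closedUpperHalf_mem_nhds hx)).differentiableAt one_ne_zero

lemma pdN_eq_fderivWithin {ν : Fin n} (P : Eu n → ℝ) (j : Fin n) {x : Eu n}
    (hx : x ∈ upperHalf ν) :
    pdN j P x = fderivWithin ℝ P (closedUpperHalf ν) x (EuclideanSpace.single j 1) := by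
  rw [fderivWithin_of_mem_nhds (closedUpperHalf_mem_nhds hx), pdN]

lemma continuousOn_fderivWithin_single {ν : Fin n} {P : Eu n → ℝ}
    (hP : ContDiffOn ℝ 1 P (closedUpperHalf ν)) (j : Fin n) :
    ContinuousOn (fun x => fderivWithin ℝ P (closedUpperHalf ν) x (EuclideanSpace.single j 1))
      (closedUpperHalf ν) :=
  (hP.continuousOn_fderivWithin (uniqueDiffOn_closedUpperHalf ν) le_rfl).clm_apply
    continuousOn_const

lemma pdN_eq_zero_of_lt_norm {P : Eu n → ℝ} {L : ℝ} (h0 : ∀ x, L ≤ ‖x‖ → P x = 0) (j : Fin n)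
    {x : Eu n} (hx : L < ‖x‖) : pdN j P x = 0 := by
  have : P =ᶠ[nhds x] fun _ => 0 := by
    filter_upwards [(isOpen_lt continuous_const continuous_norm).mem_nhds hx] with y hy
    exact h0 y hy.le
  rw [pdN, this.fderiv_eq]
  simp

lemma isCompact_closedUpperHalf_inter (ν : Fin n) (L : ℝ) :
    IsCompact (closedUpperHalf ν ∩ Metric.closedBall 0 L) :=
  (isCompact_closedBall 0 L).inter_left (isClosed_closedUpperHalf ν)

lemma integrableOn_upperHalf_of_eq {ν : Fin n} {F G : Eu n → ℝ} {L : ℝ}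
    (hG : ContinuousOn G (closedUpperHalf ν)) (hFG : Set.EqOn F G (upperHalf ν))
    (h0 : ∀ x, L < ‖x‖ → F x = 0) : IntegrableOn F (upperHalf ν) := by
  have h1 : IntegrableOn G (closedUpperHalf ν ∩ Metric.closedBall 0 L) :=
    (hG.mono Set.inter_subset_left).integrableOn_compact (isCompact_closedUpperHalf_inter ν L)
  have h2 : IntegrableOn F (upperHalf ν ∩ Metric.closedBall 0 L) := by
    refine (h1.mono_set (Set.inter_subset_inter_left _ (upperHalf_subset ν))).congr_fun ?_
      ((measurableSet_upperHalf ν).inter measurableSet_closedBall)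
    intro x hx
    exact (hFG hx.1).symm
  refine h2.of_forall_sdiff_eq_zero (measurableSet_upperHalf ν) ?_
  intro x hx
  refine h0 x ?_
  by_contra h
  exact hx.2 ⟨hx.1, by simpa using not_lt.1 h⟩

lemma integrableOn_pdN {ν : Fin n} {P : Eu n → ℝ} (hP : ContDiffOn ℝ 1 P (closedUpperHalf ν))
    {L : ℝ} (h0 : ∀ x, L ≤ ‖x‖ → P x = 0) (j : Fin n) :
    IntegrableOn (pdN j P) (upperHalf ν) :=
  integrableOn_upperHalf_of_eq (continuousOn_fderivWithin_single hP j)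
    (fun _ hx => pdN_eq_fderivWithin P j hx) (fun _ hx => pdN_eq_zero_of_lt_norm h0 j hx)

lemma exists_bound_pdN {ν : Fin n} {P : Eu n → ℝ} (hP : ContDiffOn ℝ 1 P (closedUpperHalf ν))
    {L : ℝ} (h0 : ∀ x, L ≤ ‖x‖ → P x = 0) (j : Fin n) :
    ∃ C, ∀ x ∈ upperHalf ν, |pdN j P x| ≤ C := by
  obtain ⟨C, hC⟩ := (isCompact_closedUpperHalf_inter ν L).exists_bound_of_continuousOn
    ((continuousOn_fderivWithin_single hP j).mono Set.inter_subset_left)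
  refine ⟨max C 0, fun x hx => ?_⟩
  by_cases h : ‖x‖ ≤ L
  · rw [pdN_eq_fderivWithin P j hx]
    exact (hC x ⟨upperHalf_subset ν hx, by simpa using h⟩).trans (le_max_left _ _)
  · rw [pdN_eq_zero_of_lt_norm h0 j (not_le.1 h)]
    simp

lemma abs_apply_le_norm (x : Eu n) (i : Fin n) : |x i| ≤ ‖x‖ := by
  simpa using PiLp.norm_apply_le x i

/-- A compactly supported `C¹` function vanishing on the boundary of the half-space has
derivatives of integral zero. -/
lemma setIntegral_pdN_eq_zero {ν : Fin n} {P : Eu n → ℝ}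
    (hP : ContDiffOn ℝ 1 P (closedUpperHalf ν)) {L : ℝ} (h0 : ∀ x, L ≤ ‖x‖ → P x = 0)
    (hb : ∀ x, x ν = 0 → P x = 0) (j : Fin n) :
    ∫ x in upperHalf ν, pdN j P x = 0 := by
  wlog hL : 0 < L generalizing L
  · exact this (L := 1) (fun x hx => h0 x (by linarith)) one_pos
  cases n with
  | zero => exact ν.elim0
  | succ n =>
  set T : (Fin (n + 1) → ℝ) → Eu (n + 1) := WithLp.toLp 2 with hT
  let eT : (Fin (n + 1) → ℝ) ≃L[ℝ] Eu (n + 1) :=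
    (PiLp.continuousLinearEquiv 2 ℝ (fun _ : Fin (n + 1) => ℝ)).symm
  have hmp : MeasurePreserving T := PiLp.volume_preserving_toLp _
  have hemb : MeasurableEmbedding T := (MeasurableEquiv.toLp 2 _).measurableEmbedding
  set a : Fin (n + 1) → ℝ := fun i => if i = ν then 0 else -(L + 1) with ha
  set b : Fin (n + 1) → ℝ := fun _ => L + 1 with hb'
  have hab : a ≤ b := by
    intro i
    simp only [ha, hb']
    split_ifs <;> linarith
  have hIoo : ∀ y ∈ Set.pi Set.univ (fun i => Set.Ioo (a i) (b i)), T y ∈ upperHalf ν := by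
    intro y hy
    have := (hy ν (Set.mem_univ _)).1
    simpa [ha, upperHalf, hT] using this
  have hIcc : ∀ y ∈ Set.Icc a b, T y ∈ closedUpperHalf ν := by
    intro y hy
    have := hy.1 ν
    simpa [ha, closedUpperHalf, hT] using this
  have hae : (Set.pi Set.univ fun i => Set.Ioo (a i) (b i)) =ᵐ[volume] Set.Icc a b :=
    Measure.univ_pi_Ioo_ae_eq_Icc
  have hint : IntegrableOn (fun y => pdN j P (T y)) (Set.Icc a b) := by
    refine IntegrableOn.congr_set_ae ?_ hae.symm
    have h1 := (hmp.integrableOn_comp_preimage hemb).2 (integrableOn_pdN hP h0 j)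
    exact h1.mono_set hIoo
  have key := integral_divergence_of_hasFDerivAt_off_countable' a b hab
    (fun i y => if i = j then P (T y) else 0)
    (fun i y => if i = j then (fderiv ℝ P (T y)).comp (eT : (Fin (n + 1) → ℝ) →L[ℝ] Eu (n + 1))
      else 0) ∅ Set.countable_empty ?_ ?_ ?_
  · have hsum : ∀ y : Fin (n + 1) → ℝ, (∑ i, (if i = j then
        (fderiv ℝ P (T y)).comp (eT : (Fin (n + 1) → ℝ) →L[ℝ] Eu (n + 1)) else 0)
          (Pi.single i 1)) = pdN j P (T y) := by
      intro y
      rw [Finset.sum_eq_single j]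
      · simp only [if_true, pdN]
        rfl
      · intro i _ hi
        simp [hi]
      · simp
    simp only [hsum] at key
    have hz : ∀ c : ℝ, (c = L + 1 ∨ c = a j) → ∀ y : Fin n → ℝ, P (T (j.insertNth c y)) = 0 := by
      intro c hc y
      have hval : (T (j.insertNth c y)) j = c := by simp [hT]
      have hnorm : |c| = L + 1 → P (T (j.insertNth c y)) = 0 := by
        intro hcL
        have h1 := abs_apply_le_norm (T (j.insertNth c y)) j
        rw [hval, hcL] at h1
        exact h0 _ (by linarith)
      rcases hc with hc | hc
      · exact hnorm (by rw [hc, abs_of_pos (by linarith)])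
      · by_cases hj : j = ν
        · refine hb _ ?_
          rw [← hj, hval, hc]
          simp [ha, hj]
        · refine hnorm ?_
          rw [hc]
          simp only [ha, hj, if_false, abs_neg]
          exact abs_of_pos (by linarith)
    have hR : (∑ i : Fin (n + 1), ((∫ x in Set.Icc (a ∘ i.succAbove) (b ∘ i.succAbove),
        if i = j then P (T (i.insertNth (b i) x)) else 0) -
          ∫ x in Set.Icc (a ∘ i.succAbove) (b ∘ i.succAbove),
            if i = j then P (T (i.insertNth (a i) x)) else 0)) = 0 := by
      refine Finset.sum_eq_zero fun i _ => ?_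
      by_cases hi : i = j
      · subst hi
        simp [hz (b i) (Or.inl rfl), hz (a i) (Or.inr rfl)]
      · simp [hi]
    rw [hR] at key
    rw [← setIntegral_congr_set hae] at key
    rw [← key, ← hmp.setIntegral_preimage_emb hemb]
    refine setIntegral_eq_of_subset_of_forall_sdiff_eq_zero
      (hmp.measurable (measurableSet_upperHalf ν)) hIoo ?_
    intro y hy
    by_contra hne
    have hnorm : ‖T y‖ ≤ L := by
      by_contra h
      exact hne (pdN_eq_zero_of_lt_norm h0 j (not_le.1 h))
    have hyν : 0 < y ν := hy.1
    have hyi : ∀ i, |y i| ≤ L := fun i => (abs_apply_le_norm (T y) i).trans hnorm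
    refine hy.2 fun i _ => ?_
    have hi := abs_le.1 (hyi i)
    refine ⟨?_, by simp only [hb']; linarith⟩
    by_cases h : i = ν
    · simpa [ha, h] using hyν
    · simp only [ha, h, if_false]
      linarith
  · intro i
    by_cases hi : i = j
    · simp only [hi, if_true]
      exact hP.continuousOn.comp eT.continuous.continuousOn hIcc
    · simp only [hi, if_false]
      exact continuousOn_const
  · intro y hy i
    by_cases hi : i = j
    · simp only [hi, if_true]
      exact (differentiableAt_of_mem_upperHalf hP (hIoo y hy.1)).hasFDerivAt.comp y
        eT.hasFDerivAt
    · simp only [hi, if_false]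
      exact hasFDerivAt_const _ _
  · refine hint.congr_fun ?_ measurableSet_Icc
    intro y _
    simp only
    rw [Finset.sum_eq_single j]
    · simp only [if_true, pdN]
      rfl
    · intro i _ hi
      simp [hi]
    · simp

lemma pdN_mul {f g : Eu n → ℝ} {x : Eu n} (hf : DifferentiableAt ℝ f x)
    (hg : DifferentiableAt ℝ g x) (j : Fin n) :
    pdN j (fun y => f y * g y) x = pdN j f x * g x + f x * pdN j g x := by
  simp only [pdN]
  rw [fderiv_fun_mul hf hg]
  simp only [add_apply, smul_apply, smul_eq_mul]
  ring

lemma pdN_comp_add_right (f : Eu n → ℝ) (a x : Eu n) (j : Fin n) :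
    pdN j (fun y => f (y + a)) x = pdN j f (x + a) := by
  simp only [pdN]
  rw [fderiv_comp_add_right]

lemma integrableOn_pdN_mul {ν : Fin n} {g p : Eu n → ℝ}
    (hg : ContDiffOn ℝ 1 g (closedUpperHalf ν)) (hp : ContinuousOn p (closedUpperHalf ν))
    {L : ℝ} (h0 : ∀ x, L ≤ ‖x‖ → g x = 0) (j : Fin n) :
    IntegrableOn (fun x => pdN j g x * p x) (upperHalf ν) := by
  refine integrableOn_upperHalf_of_eq ((continuousOn_fderivWithin_single hg j).mul hp) (L := L)
    ?_ ?_
  · intro x hx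
    simp [pdN_eq_fderivWithin g j hx]
  · intro x hx
    simp [pdN_eq_zero_of_lt_norm h0 j hx]

lemma integrableOn_mul_pdN {ν : Fin n} {g p : Eu n → ℝ}
    (hg : ContinuousOn g (closedUpperHalf ν)) (hp : ContDiffOn ℝ 1 p (closedUpperHalf ν))
    {L : ℝ} (h0 : ∀ x, L ≤ ‖x‖ → g x = 0) (j : Fin n) :
    IntegrableOn (fun x => g x * pdN j p x) (upperHalf ν) := by
  refine integrableOn_upperHalf_of_eq (hg.mul (continuousOn_fderivWithin_single hp j)) (L := L)
    ?_ ?_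
  · intro x hx
    simp [pdN_eq_fderivWithin p j hx]
  · intro x hx
    simp [h0 x hx.le]

/-- Integration by parts on the half-space. -/
lemma setIntegral_pdN_mul {ν : Fin n} {g p : Eu n → ℝ}
    (hg : ContDiffOn ℝ 1 g (closedUpperHalf ν)) (hp : ContDiffOn ℝ 1 p (closedUpperHalf ν))
    {L : ℝ} (h0 : ∀ x, L ≤ ‖x‖ → g x = 0) (hb : ∀ x, x ν = 0 → g x = 0) (j : Fin n) :
    ∫ x in upperHalf ν, pdN j g x * p x = -∫ x in upperHalf ν, g x * pdN j p x := by
  have h := setIntegral_pdN_eq_zero (hg.mul hp) (L := L)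
    (fun x hx => by simp [h0 x hx]) (fun x hx => by simp [hb x hx]) j
  have h' : ∫ x in upperHalf ν, pdN j (fun y => g y * p y) x =
      ∫ x in upperHalf ν, (pdN j g x * p x + g x * pdN j p x) := by
    refine setIntegral_congr_fun (measurableSet_upperHalf ν) fun x hx => ?_
    exact pdN_mul (differentiableAt_of_mem_upperHalf hg hx)
      (differentiableAt_of_mem_upperHalf hp hx) j
  have h2 := integral_add (integrableOn_pdN_mul hg hp.continuousOn h0 j)
    (integrableOn_mul_pdN hg.continuousOn hp h0 j)
  have h3 : ∫ x in upperHalf ν, pdN j (fun y => g y * p y) x = 0 := h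
  linarith

lemma add_smul_single_mem_upperHalf {ν i : Fin n} (hi : i ≠ ν) (t : ℝ) (x : Eu n) :
    x + t • EuclideanSpace.single i (1 : ℝ) ∈ upperHalf ν ↔ x ∈ upperHalf ν := by
  simp [upperHalf, hi.symm]

lemma add_smul_single_mem_closedUpperHalf {ν i : Fin n} (hi : i ≠ ν) (t : ℝ) (x : Eu n) :
    x + t • EuclideanSpace.single i (1 : ℝ) ∈ closedUpperHalf ν ↔ x ∈ closedUpperHalf ν := by
  simp [closedUpperHalf, hi.symm]

lemma contDiffOn_comp_add_smul_single {ν i : Fin n} (hi : i ≠ ν) (t : ℝ) {p : Eu n → ℝ}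
    (hp : ContDiffOn ℝ 1 p (closedUpperHalf ν)) :
    ContDiffOn ℝ 1 (fun x => p (x + t • EuclideanSpace.single i (1 : ℝ)))
      (closedUpperHalf ν) := by
  refine hp.comp (by fun_prop) ?_
  intro x hx
  exact (add_smul_single_mem_closedUpperHalf hi t x).2 hx

lemma setIntegral_upperHalf_comp_add {ν i : Fin n} (hi : i ≠ ν) (t : ℝ) (f : Eu n → ℝ) :
    ∫ x in upperHalf ν, f (x + t • EuclideanSpace.single i (1 : ℝ)) =
      ∫ x in upperHalf ν, f x := by
  rw [← integral_indicator (measurableSet_upperHalf ν),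
    ← integral_indicator (measurableSet_upperHalf ν),
    ← integral_add_right_eq_self ((upperHalf ν).indicator f) (t • EuclideanSpace.single i (1 : ℝ))]
  refine integral_congr_ae (Filter.Eventually.of_forall fun x => ?_)
  by_cases hx : x ∈ upperHalf ν
  · simp only
    rw [Set.indicator_of_mem hx,
      Set.indicator_of_mem ((add_smul_single_mem_upperHalf hi t x).2 hx)]
  · simp only
    rw [Set.indicator_of_notMem hx,
      Set.indicator_of_notMem (fun h => hx ((add_smul_single_mem_upperHalf hi t x).1 h))]

lemma hasDerivAt_comp_add_smul {p : Eu n → ℝ} {x : Eu n} {i : Fin n} {t : ℝ}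
    (hp : DifferentiableAt ℝ p (x + t • EuclideanSpace.single i (1 : ℝ))) :
    HasDerivAt (fun s : ℝ => p (x + s • EuclideanSpace.single i (1 : ℝ)))
      (pdN i p (x + t • EuclideanSpace.single i (1 : ℝ))) t := by
  have h1 : HasDerivAt (fun s : ℝ => x + s • EuclideanSpace.single i (1 : ℝ))
      (EuclideanSpace.single i (1 : ℝ)) t := by
    simpa using ((hasDerivAt_id t).smul_const (EuclideanSpace.single i (1 : ℝ))).const_add x
  exact hp.hasFDerivAt.comp_hasDerivAt t h1

/-- Differentiation under the integral of a tangential translation. -/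
lemma hasDerivAt_setIntegral_translate {ν i : Fin n} (hi : i ≠ ν) {q p : Eu n → ℝ}
    (hq : IntegrableOn q (upperHalf ν)) (hp : ContDiffOn ℝ 1 p (closedUpperHalf ν))
    {L : ℝ} (h0 : ∀ x, L ≤ ‖x‖ → p x = 0) :
    HasDerivAt (fun t : ℝ => ∫ x in upperHalf ν, q x * p (x + t • EuclideanSpace.single i (1 : ℝ)))
      (∫ x in upperHalf ν, q x * pdN i p x) 0 := by
  obtain ⟨C, hC⟩ := exists_bound_pdN hp h0 i
  obtain ⟨D, hD⟩ : ∃ D, ∀ x ∈ closedUpperHalf ν, ‖p x‖ ≤ D := by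
    obtain ⟨D, hD⟩ := (isCompact_closedUpperHalf_inter ν L).exists_bound_of_continuousOn
      (hp.continuousOn.mono Set.inter_subset_left)
    refine ⟨max D 0, fun x hx => ?_⟩
    by_cases h : ‖x‖ ≤ L
    · exact (hD x ⟨hx, by simpa using h⟩).trans (le_max_left _ _)
    · simp [h0 x (not_le.1 h).le]
  have hFint : ∀ t : ℝ, IntegrableOn
      (fun x => q x * p (x + t • EuclideanSpace.single i (1 : ℝ))) (upperHalf ν) := by
    intro t
    refine Integrable.mul_bdd (c := D) hq ?_ ?_
    · exact ((contDiffOn_comp_add_smul_single hi t hp).continuousOn.mono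
        (upperHalf_subset ν)).aestronglyMeasurable (measurableSet_upperHalf ν)
    · refine ae_restrict_of_forall_mem (measurableSet_upperHalf ν) fun x hx => ?_
      exact hD _ ((add_smul_single_mem_closedUpperHalf hi t x).2 (upperHalf_subset ν hx))
  have hderivMeas : AEStronglyMeasurable (pdN i p) (volume.restrict (upperHalf ν)) :=
    (integrableOn_pdN hp h0 i).aestronglyMeasurable
  have key := (hasDerivAt_integral_of_dominated_loc_of_deriv_le
    (μ := volume.restrict (upperHalf ν)) (x₀ := (0 : ℝ)) (s := Set.univ)
    (F := fun t x => q x * p (x + t • EuclideanSpace.single i (1 : ℝ)))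
    (F' := fun t x => q x * pdN i p (x + t • EuclideanSpace.single i (1 : ℝ)))
    (bound := fun x => ‖q x‖ * C) Filter.univ_mem
    (Filter.Eventually.of_forall fun t => (hFint t).aestronglyMeasurable) (hFint 0)
    (by simp only [zero_smul, add_zero]; exact hq.aestronglyMeasurable.mul hderivMeas)
    ?_ (hq.norm.mul_const C) ?_).2
  · simpa using key
  · refine ae_restrict_of_forall_mem (measurableSet_upperHalf ν) fun x hx t _ => ?_
    rw [norm_mul]
    exact mul_le_mul_of_nonneg_left (hC _ ((add_smul_single_mem_upperHalf hi t x).2 hx))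
      (norm_nonneg _)
  · refine ae_restrict_of_forall_mem (measurableSet_upperHalf ν) fun x hx t _ => ?_
    exact (hasDerivAt_comp_add_smul (differentiableAt_of_mem_upperHalf hp
      ((add_smul_single_mem_upperHalf hi t x).2 hx))).const_mul (q x)

/-- For `C¹` functions with `g = 0` on the boundary and a tangential direction `i`, the two
derivatives in `∫ ∂_j g ∂_i p` may be exchanged. -/
lemma setIntegral_pdN_mul_pdN_comm {ν i : Fin n} (hi : i ≠ ν) {g p : Eu n → ℝ}
    (hg : ContDiffOn ℝ 1 g (closedUpperHalf ν)) (hp : ContDiffOn ℝ 1 p (closedUpperHalf ν))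
    {L : ℝ} (hg0 : ∀ x, L ≤ ‖x‖ → g x = 0) (hp0 : ∀ x, L ≤ ‖x‖ → p x = 0)
    (hb : ∀ x, x ν = 0 → g x = 0) (j : Fin n) :
    ∫ x in upperHalf ν, pdN j g x * pdN i p x = ∫ x in upperHalf ν, pdN i g x * pdN j p x := by
  have h1 := hasDerivAt_setIntegral_translate hi (integrableOn_pdN hg hg0 j) hp hp0
  have h2 := hasDerivAt_setIntegral_translate hi (integrableOn_pdN hp hp0 j) hg hg0
  have h3 : (fun t : ℝ => ∫ x in upperHalf ν, pdN j g x *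
      p (x + t • EuclideanSpace.single i (1 : ℝ))) =
      fun t : ℝ => -∫ x in upperHalf ν, pdN j p x *
        g (x + (-t) • EuclideanSpace.single i (1 : ℝ)) := by
    funext t
    rw [setIntegral_pdN_mul hg (contDiffOn_comp_add_smul_single hi t hp) hg0 hb j,
      ← setIntegral_upperHalf_comp_add hi t
        (fun x => pdN j p x * g (x + (-t) • EuclideanSpace.single i (1 : ℝ)))]
    congr 1
    refine integral_congr_ae (Filter.Eventually.of_forall fun x => ?_)
    simp only [pdN_comp_add_right]
    rw [mul_comm]
    simp
  rw [h3] at h1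
  have h4 : HasDerivAt (fun t : ℝ => -∫ x in upperHalf ν, pdN j p x *
        g (x + (-t) • EuclideanSpace.single i (1 : ℝ)))
        (∫ x in upperHalf ν, pdN j p x * pdN i g x) 0 := by
    have h5 : HasDerivAt (fun t : ℝ => ∫ x in upperHalf ν, pdN j p x *
        g (x + t • EuclideanSpace.single i (1 : ℝ)))
        (∫ x in upperHalf ν, pdN j p x * pdN i g x) (-0) := by simpa using h2
    exact (h5.comp (0 : ℝ) (hasDerivAt_neg (0 : ℝ))).neg.congr_deriv (by simp)
  rw [h1.unique h4]
  simp only [mul_comm]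

end HalfSpace

section HalfBall

/-- The open half-ball `{|x| < ρ, x_ν > 0}` with normal direction `ν`. -/
def nuHalfBall (ν : Fin n) (ρ : ℝ) : Set (Eu n) := {x | ‖x‖ < ρ ∧ 0 < x ν}

lemma isOpen_nuHalfBall (ν : Fin n) (ρ : ℝ) : IsOpen (nuHalfBall ν ρ) :=
  (isOpen_lt continuous_norm continuous_const).inter (isOpen_upperHalf ν)

lemma measurableSet_nuHalfBall (ν : Fin n) (ρ : ℝ) : MeasurableSet (nuHalfBall ν ρ) :=
  (isOpen_nuHalfBall ν ρ).measurableSet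

lemma nuHalfBall_mono (ν : Fin n) {r R : ℝ} (h : r ≤ R) : nuHalfBall ν r ⊆ nuHalfBall ν R :=
  fun _ hx => ⟨hx.1.trans_le h, hx.2⟩

lemma nuHalfBall_subset_upperHalf (ν : Fin n) (ρ : ℝ) : nuHalfBall ν ρ ⊆ upperHalf ν :=
  fun _ hx => hx.2

lemma convex_nuHalfBall (ν : Fin n) (ρ : ℝ) : Convex ℝ (nuHalfBall ν ρ) := by
  have h1 : Convex ℝ (upperHalf ν) :=
    convex_halfSpace_gt (f := fun x : Eu n => x ν) ⟨fun _ _ => rfl, fun _ _ => rfl⟩ 0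
  have h2 := (convex_ball (0 : Eu n) ρ).inter h1
  have h3 : nuHalfBall ν ρ = Metric.ball 0 ρ ∩ upperHalf ν := by
    ext x
    simp [nuHalfBall, upperHalf]
  rw [h3]
  exact h2

lemma uniqueDiffOn_closure_nuHalfBall (ν : Fin n) {ρ : ℝ} (hρ : 0 < ρ) :
    UniqueDiffOn ℝ (closure (nuHalfBall ν ρ)) := by
  refine uniqueDiffOn_convex (convex_nuHalfBall ν ρ).closure
    ⟨EuclideanSpace.single ν (ρ / 2), ?_⟩
  refine interior_mono subset_closure ?_
  rw [(isOpen_nuHalfBall ν ρ).interior_eq]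
  refine ⟨?_, ?_⟩
  · simp [abs_of_pos hρ, hρ]
  · simp [hρ]

lemma closure_nuHalfBall_subset (ν : Fin n) (ρ : ℝ) :
    closure (nuHalfBall ν ρ) ⊆ closedUpperHalf ν ∩ Metric.closedBall 0 ρ := by
  refine closure_minimal ?_ ((isClosed_closedUpperHalf ν).inter Metric.isClosed_closedBall)
  intro x hx
  exact ⟨upperHalf_subset ν hx.2, by simpa using hx.1.le⟩

lemma isCompact_closure_nuHalfBall (ν : Fin n) (ρ : ℝ) :
    IsCompact (closure (nuHalfBall ν ρ)) :=
  (isCompact_closedUpperHalf_inter ν ρ).of_isClosed_subset isClosed_closure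
    (closure_nuHalfBall_subset ν ρ)

lemma mem_closure_nuHalfBall {ν : Fin n} {ρ : ℝ} {x : Eu n} (hx : ‖x‖ < ρ) (hν : 0 ≤ x ν) :
    x ∈ closure (nuHalfBall ν ρ) := by
  have hc : Continuous fun t : ℝ => x + t • EuclideanSpace.single ν (1 : ℝ) := by fun_prop
  have hx0 : x + (0 : ℝ) • EuclideanSpace.single ν (1 : ℝ) = x := by simp
  have ht : Filter.Tendsto (fun t : ℝ => x + t • EuclideanSpace.single ν (1 : ℝ))
      (nhdsWithin 0 (Set.Ioi 0)) (nhds x) := by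
    have := hc.tendsto 0
    rw [hx0] at this
    exact this.mono_left nhdsWithin_le_nhds
  refine mem_closure_of_tendsto ht ?_
  have h1 := ht.eventually ((isOpen_lt continuous_norm continuous_const).mem_nhds hx)
  filter_upwards [h1, self_mem_nhdsWithin] with t h1 h2
  refine ⟨h1, ?_⟩
  have h2' : 0 < t := h2
  simp only [PiLp.add_apply, PiLp.smul_apply, PiLp.single_apply, if_true, smul_eq_mul,
    mul_one]
  linarith

lemma nhdsWithin_closure_nuHalfBall {ν : Fin n} {ρ : ℝ} {x : Eu n} (hx : ‖x‖ < ρ) :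
    nhdsWithin x (closure (nuHalfBall ν ρ)) = nhdsWithin x (closedUpperHalf ν) := by
  have hU : Metric.ball (0 : Eu n) ρ ∈ nhds x := Metric.isOpen_ball.mem_nhds (by simpa using hx)
  refine nhdsWithin_eq_nhdsWithin (s := Metric.ball 0 ρ) (by simpa using hx)
    Metric.isOpen_ball ?_
  ext y
  constructor
  · rintro ⟨h1, h2⟩
    exact ⟨(closure_nuHalfBall_subset ν ρ h1).1, h2⟩
  · rintro ⟨h1, h2⟩
    exact ⟨mem_closure_nuHalfBall (by simpa using h2) h1, h2⟩

/-- Partial derivative within the set `K`. -/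
def pdWithin (K : Set (Eu n)) (i : Fin n) (v : Eu n → ℝ) : Eu n → ℝ :=
  fun x => fderivWithin ℝ v K x (EuclideanSpace.single i 1)

lemma pdWithin_eq_pdN {K U : Set (Eu n)} (hU : IsOpen U) (hUK : U ⊆ K) (i : Fin n)
    (v : Eu n → ℝ) : Set.EqOn (pdWithin K i v) (pdN i v) U := by
  intro x hx
  simp only [pdWithin, pdN]
  rw [fderivWithin_of_mem_nhds (Filter.mem_of_superset (hU.mem_nhds hx) hUK)]

lemma pdN_congr_of_isOpen {U : Set (Eu n)} (hU : IsOpen U) {f g : Eu n → ℝ}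
    (h : Set.EqOn f g U) (i : Fin n) : Set.EqOn (pdN i f) (pdN i g) U := by
  intro x hx
  simp only [pdN]
  rw [(h.eventuallyEq_of_mem (hU.mem_nhds hx)).fderiv_eq]

lemma pdWithin_congr {K : Set (Eu n)} {f g : Eu n → ℝ}
    (h : Set.EqOn f g K) (i : Fin n) : Set.EqOn (pdWithin K i f) (pdWithin K i g) K := by
  intro x hx
  simp only [pdWithin]
  rw [fderivWithin_congr h (h hx)]

lemma contDiffOn_pdWithin {K : Set (Eu n)} (hK : UniqueDiffOn ℝ K) {m : ℕ} {v : Eu n → ℝ}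
    (hv : ContDiffOn ℝ (m + 1 : ℕ) v K) (i : Fin n) : ContDiffOn ℝ m (pdWithin K i v) K :=
  (hv.fderivWithin hK (by norm_cast)).clm_apply contDiffOn_const

lemma pdWithin_comm {K : Set (Eu n)} (hK : UniqueDiffOn ℝ K) (hint : K ⊆ closure (interior K))
    {v : Eu n → ℝ} (hv : ContDiffOn ℝ 2 v K) (i j : Fin n) :
    Set.EqOn (pdWithin K i (pdWithin K j v)) (pdWithin K j (pdWithin K i v)) K := by
  intro x hx
  have hsymm : IsSymmSndFDerivWithinAt ℝ v K x :=
    (hv x hx).isSymmSndFDerivWithinAt (by simp) hK (hint hx) hx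
  have hd : DifferentiableWithinAt ℝ (fderivWithin ℝ v K) K x :=
    (hv.fderivWithin hK (m := 1) (by norm_num)).differentiableOn one_ne_zero x hx
  have h : ∀ a b : Fin n, pdWithin K a (pdWithin K b v) x =
      fderivWithin ℝ (fderivWithin ℝ v K) K x (EuclideanSpace.single a 1)
        (EuclideanSpace.single b 1) := by
    intro a b
    have he : pdWithin K b v = fun y => fderivWithin ℝ v K y (EuclideanSpace.single b 1) := rfl
    rw [he]
    simp only [pdWithin]
    rw [fderivWithin_clm_apply (hK x hx) hd (differentiableWithinAt_const _)]
    simp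
  rw [h, h]
  exact hsymm.eq _ _

lemma pdWithin_eq_zero_on_flat {ν i : Fin n} (hi : i ≠ ν) {ρ : ℝ} {v : Eu n → ℝ}
    (hv : DifferentiableOn ℝ v (closure (nuHalfBall ν ρ)))
    (h0 : ∀ x, ‖x‖ < ρ → x ν = 0 → v x = 0) {x : Eu n} (hx : ‖x‖ < ρ) (hxν : x ν = 0) :
    pdWithin (closure (nuHalfBall ν ρ)) i v x = 0 := by
  have hxK := mem_closure_nuHalfBall hx hxν.ge
  have hd := (hv x hxK).hasFDerivWithinAt
  have hν : ∀ t : ℝ, (x + t • EuclideanSpace.single i (1 : ℝ)) ν = 0 := by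
    intro t
    simp [hxν, hi.symm]
  have hc : Continuous fun t : ℝ => x + t • EuclideanSpace.single i (1 : ℝ) := by fun_prop
  have hnear : ∀ᶠ t in nhds (0 : ℝ), ‖x + t • EuclideanSpace.single i (1 : ℝ)‖ < ρ := by
    refine hc.norm.tendsto 0 |>.eventually (gt_mem_nhds ?_)
    simpa using hx
  set S : Set ℝ := {t | ‖x + t • EuclideanSpace.single i (1 : ℝ)‖ < ρ} with hS
  have hSn : S ∈ nhds (0 : ℝ) := hnear
  have h1 : HasDerivWithinAt (fun s : ℝ => x + s • EuclideanSpace.single i (1 : ℝ))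
      (EuclideanSpace.single i (1 : ℝ)) S 0 := by
    have : HasDerivAt (fun s : ℝ => x + s • EuclideanSpace.single i (1 : ℝ))
        (EuclideanSpace.single i (1 : ℝ)) 0 := by
      simpa using
        ((hasDerivAt_id (0 : ℝ)).smul_const (EuclideanSpace.single i (1 : ℝ))).const_add x
    exact this.hasDerivWithinAt
  have hd' : HasFDerivWithinAt v (fderivWithin ℝ v (closure (nuHalfBall ν ρ)) x)
      (closure (nuHalfBall ν ρ)) (x + (0 : ℝ) • EuclideanSpace.single i (1 : ℝ)) := by
    simpa using hd
  have h2 := hd'.comp_hasDerivWithinAt (0 : ℝ) h1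
    (fun t ht => mem_closure_nuHalfBall ht (hν t).ge)
  have h3 : HasDerivAt (v ∘ fun s : ℝ => x + s • EuclideanSpace.single i (1 : ℝ)) 0 0 := by
    refine (hasDerivAt_const (0 : ℝ) (0 : ℝ)).congr_of_eventuallyEq ?_
    filter_upwards [hnear] with t ht
    exact h0 _ ht (hν t)
  exact (h2.hasDerivAt hSn).unique h3

end HalfBall

section Cutoff

lemma exists_bound_deriv_smoothTransition : ∃ C, 0 ≤ C ∧ ∀ t, |deriv smoothTransition t| ≤ C := by
  have hc : Continuous (deriv smoothTransition) :=
    (smoothTransition.contDiff (n := 1)).continuous_deriv le_rfl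
  obtain ⟨C, hC⟩ := (isCompact_Icc (a := (0 : ℝ)) (b := 1)).exists_bound_of_continuousOn
    hc.continuousOn
  refine ⟨max C 0, le_max_right _ _, fun t => ?_⟩
  rcases lt_or_ge t 0 with h | h
  · have : smoothTransition =ᶠ[nhds t] fun _ => 0 := by
      filter_upwards [gt_mem_nhds h] with s hs
      exact smoothTransition.zero_of_nonpos hs.le
    rw [this.deriv_eq]
    simp
  rcases lt_or_ge 1 t with h' | h'
  · have : smoothTransition =ᶠ[nhds t] fun _ => 1 := by
      filter_upwards [lt_mem_nhds h'] with s hs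
      exact smoothTransition.one_of_one_le hs.le
    rw [this.deriv_eq]
    simp
  · exact (hC t ⟨h, h'⟩).trans (le_max_left _ _)

/-- A radial cutoff equal to `1` for `|x| ≤ r` and to `0` for `|x| ≥ R`. -/
def radialCutoff (r R : ℝ) (x : Eu n) : ℝ :=
  smoothTransition ((R ^ 2 - ‖x‖ ^ 2) / (R ^ 2 - r ^ 2))

variable {r R : ℝ}

lemma contDiff_radialCutoff {m : ℕ∞} : ContDiff ℝ m (radialCutoff (n := n) r R) :=
  smoothTransition.contDiff.comp
    ((contDiff_const.sub (contDiff_id.norm_sq ℝ)).div_const _)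

lemma radialCutoff_eq_one (hr : 0 ≤ r) (hrR : r < R) {x : Eu n} (hx : ‖x‖ ≤ r) :
    radialCutoff r R x = 1 := by
  refine smoothTransition.one_of_one_le ?_
  rw [one_le_div (by nlinarith)]
  nlinarith [norm_nonneg x]

lemma radialCutoff_eq_zero (hr : 0 ≤ r) (hrR : r < R) {x : Eu n} (hx : R ≤ ‖x‖) :
    radialCutoff r R x = 0 := by
  refine smoothTransition.zero_of_nonpos (div_nonpos_of_nonpos_of_nonneg ?_ ?_)
  · nlinarith
  · nlinarith

lemma radialCutoff_mem_Icc (x : Eu n) : radialCutoff r R x ∈ Set.Icc (0 : ℝ) 1 :=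
  ⟨smoothTransition.nonneg _, smoothTransition.le_one _⟩

lemma abs_pdN_radialCutoff_le {C : ℝ} (hC0 : 0 ≤ C) (hC : ∀ t, |deriv smoothTransition t| ≤ C)
    (hr : 0 ≤ r) (hrR : r < R) (j : Fin n) (x : Eu n) :
    |pdN j (radialCutoff r R) x| ≤ 2 * C / (R - r) := by
  have hpos : 0 < R - r := by linarith
  rcases lt_or_ge R ‖x‖ with h | h
  · rw [pdN_eq_zero_of_lt_norm (fun y hy => radialCutoff_eq_zero hr hrR hy) j h]
    simp only [abs_zero]
    positivity
  · have hq : 0 < R ^ 2 - r ^ 2 := by nlinarith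
    have h1 : HasFDerivAt (fun y : Eu n => (R ^ 2 - ‖y‖ ^ 2) / (R ^ 2 - r ^ 2))
        ((R ^ 2 - r ^ 2)⁻¹ • -((2 : ℝ) • innerSL ℝ x)) x := by
      have h2 := ((hasStrictFDerivAt_norm_sq x).hasFDerivAt.const_sub (R ^ 2)).mul_const
        ((R ^ 2 - r ^ 2)⁻¹)
      simpa [div_eq_mul_inv, two_smul ℝ, two_nsmul] using h2
    have h3 : DifferentiableAt ℝ smoothTransition ((R ^ 2 - ‖x‖ ^ 2) / (R ^ 2 - r ^ 2)) :=
      (smoothTransition.contDiff (n := 1)).differentiable one_ne_zero _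
    have h4 := h3.hasDerivAt.comp_hasFDerivAt x h1
    have h5 : pdN j (radialCutoff r R) x =
        deriv smoothTransition ((R ^ 2 - ‖x‖ ^ 2) / (R ^ 2 - r ^ 2)) *
          ((R ^ 2 - r ^ 2)⁻¹ * -(2 * x j)) := by
      have h6 : HasFDerivAt (radialCutoff r R) _ x := h4
      simp only [pdN]
      rw [h6.fderiv]
      simp [EuclideanSpace.inner_single_right]
    rw [h5, abs_mul, abs_mul, abs_neg, abs_mul, abs_of_pos (inv_pos.2 hq)]
    have h7 : (R ^ 2 - r ^ 2)⁻¹ * (|2| * |x j|) ≤ 2 / (R - r) := by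
      rw [inv_mul_le_iff₀ hq]
      have h8 := abs_apply_le_norm x j
      have h9 : (R ^ 2 - r ^ 2) * (2 / (R - r)) = 2 * (R + r) := by
        field_simp
        ring
      rw [h9, abs_two]
      linarith
    calc _ ≤ C * (2 / (R - r)) := mul_le_mul (hC _) h7 (by positivity) hC0
      _ = 2 * C / (R - r) := by ring

end Cutoff

section Energy

variable {ν : Fin n} {ρ r R : ℝ}

lemma contDiffOn_mul_of_support {m : ℕ} {q c : Eu n → ℝ}
    (hq : ContDiffOn ℝ m q (closure (nuHalfBall ν ρ))) (hc : ContDiff ℝ m c) {L : ℝ} (hL : L < ρ)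
    (h0 : ∀ x, L ≤ ‖x‖ → c x = 0) :
    ContDiffOn ℝ m (fun x => c x * q x) (closedUpperHalf ν) := by
  intro x hx
  rcases lt_or_ge ‖x‖ ρ with h | h
  · have h1 : ContDiffWithinAt ℝ m (fun x => c x * q x) (closure (nuHalfBall ν ρ)) x :=
      hc.contDiffAt.contDiffWithinAt.mul (hq x (mem_closure_nuHalfBall h hx))
    refine h1.mono_of_mem_nhdsWithin ?_
    rw [← nhdsWithin_closure_nuHalfBall h]
    exact self_mem_nhdsWithin
  · have h1 : (fun x => c x * q x) =ᶠ[nhds x] fun _ => 0 := by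
      filter_upwards [(isOpen_lt continuous_const continuous_norm).mem_nhds
        (show L < ‖x‖ by linarith)] with y hy
      simp [h0 y (le_of_lt hy)]
    exact (contDiffAt_const.congr_of_eventuallyEq h1).contDiffWithinAt

lemma integrableOn_nuHalfBall {q : Eu n → ℝ} (hq : ContinuousOn q (closure (nuHalfBall ν ρ)))
    (hR : R ≤ ρ) : IntegrableOn q (nuHalfBall ν R) :=
  (hq.integrableOn_compact (isCompact_closure_nuHalfBall ν ρ)).mono_set
    ((nuHalfBall_mono ν hR).trans subset_closure)

lemma subset_closure_interior_closure (ν : Fin n) (ρ : ℝ) :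
    closure (nuHalfBall ν ρ) ⊆ closure (interior (closure (nuHalfBall ν ρ))) :=
  closure_mono (interior_maximal subset_closure (isOpen_nuHalfBall ν ρ))

/-- The localized energy identity for one pair of directions. -/
lemma setIntegral_energy_identity {i : Fin n} (hi : i ≠ ν) (hr : 0 ≤ r) {R₁ : ℝ} (hrR : r < R₁)
    (hR₁ : R₁ < R) (hR : R ≤ ρ) {w : Eu n → ℝ}
    (hw : ContDiffOn ℝ 2 w (closure (nuHalfBall ν ρ)))
    (hw0 : ∀ x, ‖x‖ < ρ → x ν = 0 → w x = 0) (j : Fin n) :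
    ∫ x in nuHalfBall ν R,
      ((radialCutoff r R₁ x ^ 2 * pdWithin (closure (nuHalfBall ν ρ)) j
            (pdWithin (closure (nuHalfBall ν ρ)) i w) x +
          2 * radialCutoff r R₁ x * pdN j (radialCutoff r R₁) x *
            pdWithin (closure (nuHalfBall ν ρ)) i w x) *
        pdWithin (closure (nuHalfBall ν ρ)) j (pdWithin (closure (nuHalfBall ν ρ)) i w) x) =
    ∫ x in nuHalfBall ν R,
      ((radialCutoff r R₁ x ^ 2 * pdWithin (closure (nuHalfBall ν ρ)) i
            (pdWithin (closure (nuHalfBall ν ρ)) i w) x +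
          2 * radialCutoff r R₁ x * pdN i (radialCutoff r R₁) x *
            pdWithin (closure (nuHalfBall ν ρ)) i w x) *
        pdWithin (closure (nuHalfBall ν ρ)) j (pdWithin (closure (nuHalfBall ν ρ)) j w) x) := by
  set K := closure (nuHalfBall ν ρ) with hK
  set φ : Eu n → ℝ := radialCutoff r R₁ with hφ
  have hρ : 0 < ρ := by linarith
  have hKu : UniqueDiffOn ℝ K := uniqueDiffOn_closure_nuHalfBall ν hρ
  have hw1 : ∀ l, ContDiffOn ℝ (1 : ℕ) (pdWithin K l w) K := fun l =>
    contDiffOn_pdWithin hKu (m := 1) (by simpa using hw) l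
  have hφ0 : ∀ x, R₁ ≤ ‖x‖ → φ x = 0 := fun x hx => radialCutoff_eq_zero hr hrR hx
  set R₂ := (2 * R₁ + R) / 3 with hR₂
  set R₃ := (R₁ + 2 * R) / 3 with hR₃
  have h12 : R₁ < R₂ := by rw [hR₂]; linarith
  have h23 : R₂ < R₃ := by rw [hR₂, hR₃]; linarith
  have h3 : R₃ < R := by rw [hR₃]; linarith
  set χ : Eu n → ℝ := radialCutoff R₂ R₃ with hχ
  have hχ0 : ∀ x, R₃ ≤ ‖x‖ → χ x = 0 := fun x hx => radialCutoff_eq_zero (by linarith) h23 hx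
  set g : Eu n → ℝ := fun x => φ x ^ 2 * pdWithin K i w x with hg
  set p : Eu n → ℝ := fun x => χ x * pdWithin K j w x with hp
  have hφs : ContDiff ℝ (1 : ℕ) φ := contDiff_radialCutoff (m := 1)
  have hgs : ContDiffOn ℝ 1 g (closedUpperHalf ν) :=
    contDiffOn_mul_of_support (hw1 i) (hφs.pow 2) (L := R₁) (by linarith)
      (fun x hx => by simp [hφ0 x hx])
  have hps : ContDiffOn ℝ 1 p (closedUpperHalf ν) :=
    contDiffOn_mul_of_support (hw1 j) (contDiff_radialCutoff (m := 1)) (L := R₃) (by linarith) hχ0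
  have hg0 : ∀ x, R₁ ≤ ‖x‖ → g x = 0 := fun x hx => by simp [hg, hφ0 x hx]
  have hp0 : ∀ x, R₃ ≤ ‖x‖ → p x = 0 := fun x hx => by simp [hp, hχ0 x hx]
  have hgb : ∀ x, x ν = 0 → g x = 0 := by
    intro x hx
    rcases lt_or_ge ‖x‖ ρ with h | h
    · simp only [hg]
      rw [pdWithin_eq_zero_on_flat hi (hw.differentiableOn two_ne_zero) hw0 h hx, mul_zero]
    · exact hg0 x (by linarith)
  have key := setIntegral_pdN_mul_pdN_comm hi hgs hps (L := R)
    (fun x hx => hg0 x (by linarith)) (fun x hx => hp0 x (by linarith)) hgb j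
  have hopen := isOpen_nuHalfBall ν ρ
  have hdg : ∀ l, ∀ x ∈ nuHalfBall ν ρ, pdN l g x =
      φ x ^ 2 * pdWithin K l (pdWithin K i w) x + 2 * φ x * pdN l φ x * pdWithin K i w x := by
    intro l x hx
    have hφd : DifferentiableAt ℝ φ x := hφs.differentiable one_ne_zero x
    have hwd : DifferentiableAt ℝ (pdWithin K i w) x :=
      ((hw1 i).contDiffAt (Filter.mem_of_superset (hopen.mem_nhds hx)
        subset_closure)).differentiableAt one_ne_zero
    have e1 : g = fun y => (φ y * φ y) * pdWithin K i w y := by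
      funext y
      simp only [hg]
      ring
    rw [e1, pdN_mul (f := fun y => φ y * φ y) (hφd.mul hφd) hwd, pdN_mul hφd hφd,
      pdWithin_eq_pdN hopen subset_closure l _ hx]
    ring
  have hdp : ∀ l, ∀ x ∈ nuHalfBall ν ρ, ‖x‖ < R₂ → pdN l p x =
      pdWithin K l (pdWithin K j w) x := by
    intro l x hx hx2
    have : p =ᶠ[nhds x] pdWithin K j w := by
      filter_upwards [(isOpen_lt continuous_norm continuous_const).mem_nhds hx2] with y hy
      simp only [hp, hχ]
      rw [radialCutoff_eq_one (by linarith) h23 (le_of_lt hy), one_mul]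
    rw [pdWithin_eq_pdN hopen subset_closure l _ hx]
    simp only [pdN]
    rw [this.fderiv_eq]
  have hzero : ∀ l, ∀ x, R₁ < ‖x‖ → pdN l g x = 0 := fun l x hx =>
    pdN_eq_zero_of_lt_norm hg0 l hx
  have hprod : ∀ l l', ∫ x in upperHalf ν, pdN l g x * pdN l' p x = ∫ x in nuHalfBall ν R,
      (φ x ^ 2 * pdWithin K l (pdWithin K i w) x + 2 * φ x * pdN l φ x * pdWithin K i w x) *
        pdWithin K l' (pdWithin K j w) x := by
    intro l l'
    refine (setIntegral_eq_of_subset_of_forall_sdiff_eq_zero (measurableSet_upperHalf ν)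
      (nuHalfBall_subset_upperHalf ν R) fun x hx => ?_).trans ?_
    · have : R ≤ ‖x‖ := by
        by_contra h
        exact hx.2 ⟨not_le.1 h, hx.1⟩
      rw [hzero l x (by linarith), zero_mul]
    · refine setIntegral_congr_fun (measurableSet_nuHalfBall ν R) fun x hx => ?_
      have hx' := nuHalfBall_mono ν hR hx
      rcases lt_or_ge ‖x‖ R₂ with h | h
      · rw [hdg l x hx', hdp l' x hx' h]
      · rw [← hdg l x hx', hzero l x (by linarith)]
        simp
  rw [hprod, hprod] at key
  refine Eq.trans (setIntegral_congr_fun (measurableSet_nuHalfBall ν R) fun x hx => ?_) key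
  have hxK : x ∈ K := subset_closure (nuHalfBall_mono ν hR hx)
  rw [pdWithin_comm hKu (subset_closure_interior_closure ν ρ) hw i j hxK]

lemma energy_pointwise (φ b : ℝ) (a c d : Fin n → ℝ) (i j : Fin n) :
    φ ^ 2 * a j ^ 2 ≤ 4 * ∑ l, ((φ ^ 2 * a l + 2 * φ * d l * b) * a l -
      (φ ^ 2 * a i + 2 * φ * d i * b) * c l) + 12 * ((∑ l, d l ^ 2) * b ^ 2) +
      8 * (φ ^ 2 * (∑ l, c l) ^ 2) := by
  have h1 : ∑ l, ((φ ^ 2 * a l + 2 * φ * d l * b) * a l -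
      (φ ^ 2 * a i + 2 * φ * d i * b) * c l) =
      ∑ l, (φ ^ 2 * a l + 2 * φ * d l * b) * a l -
      (φ ^ 2 * a i + 2 * φ * d i * b) * ∑ l, c l := by
    rw [Finset.sum_sub_distrib, Finset.mul_sum]
  have h2 : 1 / 2 * ∑ l, (φ * a l) ^ 2 - 2 * ((∑ l, d l ^ 2) * b ^ 2) ≤
      ∑ l, (φ ^ 2 * a l + 2 * φ * d l * b) * a l := by
    rw [Finset.sum_mul, Finset.mul_sum, Finset.mul_sum, ← Finset.sum_sub_distrib]
    refine Finset.sum_le_sum fun l _ => ?_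
    nlinarith [sq_nonneg (φ * a l + 2 * (d l * b))]
  have h3 : ∀ l, (φ * a l) ^ 2 ≤ ∑ l, (φ * a l) ^ 2 := fun l =>
    Finset.single_le_sum (f := fun l => (φ * a l) ^ 2) (fun _ _ => sq_nonneg _)
      (Finset.mem_univ l)
  have h4 : (d i) ^ 2 * b ^ 2 ≤ (∑ l, d l ^ 2) * b ^ 2 :=
    mul_le_mul_of_nonneg_right (Finset.single_le_sum (f := fun l => (d l) ^ 2)
      (fun _ _ => sq_nonneg _) (Finset.mem_univ i)) (sq_nonneg _)
  have h5 := h3 i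
  have h6 := h3 j
  rw [h1]
  set f := ∑ l, c l
  nlinarith [sq_nonneg (φ * a i - 2 * (φ * f)), sq_nonneg (d i * b - φ * f)]

/-- Interior-tangential `H²` estimate up to the flat boundary. -/
lemma exists_energy_estimate (n : ℕ) : ∃ C : ℝ, 1 ≤ C ∧ ∀ (ν i j : Fin n) (ρ r R : ℝ)
    (w : Eu n → ℝ), i ≠ ν → 0 ≤ r → r < R → R ≤ ρ →
    ContDiffOn ℝ 2 w (closure (nuHalfBall ν ρ)) → (∀ x, ‖x‖ < ρ → x ν = 0 → w x = 0) →
    ∫ x in nuHalfBall ν r, pdWithin (closure (nuHalfBall ν ρ)) j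
        (pdWithin (closure (nuHalfBall ν ρ)) i w) x ^ 2 ≤
      C * ((∫ x in nuHalfBall ν R, (∑ l, pdWithin (closure (nuHalfBall ν ρ)) l
        (pdWithin (closure (nuHalfBall ν ρ)) l w) x) ^ 2) +
        ((R - r)⁻¹) ^ 2 * ∫ x in nuHalfBall ν R, pdWithin (closure (nuHalfBall ν ρ)) i w x ^ 2) := by
  obtain ⟨C, hC0, hC⟩ := exists_bound_deriv_smoothTransition
  refine ⟨8 + 12 * (n * (4 * C) ^ 2), by nlinarith [show 0 ≤ 12 * (n * (4 * C) ^ 2) by positivity],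
    ?_⟩
  intro ν i j ρ r R w hi hr hrR hR hw hw0
  set K := closure (nuHalfBall ν ρ) with hK
  have hρ : 0 < ρ := by linarith
  have hKu : UniqueDiffOn ℝ K := uniqueDiffOn_closure_nuHalfBall ν hρ
  set R₁ := (r + R) / 2 with hR₁
  have h1 : r < R₁ := by rw [hR₁]; linarith
  have h2 : R₁ < R := by rw [hR₁]; linarith
  set φ : Eu n → ℝ := radialCutoff r R₁ with hφ
  have hw1 : ∀ l, ContDiffOn ℝ (1 : ℕ) (pdWithin K l w) K := fun l =>
    contDiffOn_pdWithin hKu (m := 1) (by simpa using hw) l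
  have hcb : ContinuousOn (pdWithin K i w) K := (hw1 i).continuousOn
  have hca : ∀ l l', ContinuousOn (pdWithin K l (pdWithin K l' w)) K := fun l l' =>
    (contDiffOn_pdWithin hKu (m := 0) (by simpa using hw1 l') l).continuousOn
  have hφc : ContinuousOn φ K := (contDiff_radialCutoff (m := 0)).continuous.continuousOn
  have hdφc : ∀ l, ContinuousOn (pdN l φ) K := fun l =>
    (((contDiff_radialCutoff (m := 1)).continuous_fderiv one_ne_zero).clm_apply
      continuous_const).continuousOn
  set a : Fin n → Eu n → ℝ := fun l => pdWithin K l (pdWithin K i w) with ha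
  set b : Eu n → ℝ := pdWithin K i w with hb
  set c : Fin n → Eu n → ℝ := fun l => pdWithin K l (pdWithin K l w) with hc
  set f : Eu n → ℝ := fun x => ∑ l, c l x with hf
  have hac : ∀ l, ContinuousOn (a l) K := fun l => hca l i
  have hcc : ∀ l, ContinuousOn (c l) K := fun l => hca l l
  have hfc : ContinuousOn f K := continuousOn_finsetSum _ fun l _ => hcc l
  have hXc : ∀ l, ContinuousOn (fun x => (φ x ^ 2 * a l x + 2 * φ x * pdN l φ x * b x) * a l x -
      (φ x ^ 2 * a i x + 2 * φ x * pdN i φ x * b x) * c l x) K := by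
    intro l
    have := hac l
    have := hac i
    have := hcc l
    have := hdφc l
    have := hdφc i
    fun_prop
  have hX0 : ∀ l, ∫ x in nuHalfBall ν R, ((φ x ^ 2 * a l x + 2 * φ x * pdN l φ x * b x) * a l x -
      (φ x ^ 2 * a i x + 2 * φ x * pdN i φ x * b x) * c l x) = 0 := by
    intro l
    have := hac l
    have := hac i
    have := hcc l
    have := hdφc l
    have := hdφc i
    rw [integral_sub (integrableOn_nuHalfBall (by fun_prop) hR)
      (integrableOn_nuHalfBall (by fun_prop) hR), sub_eq_zero]
    exact setIntegral_energy_identity hi hr h1 h2 hR hw hw0 l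
  have hXint : ∀ l, IntegrableOn (fun x => (φ x ^ 2 * a l x + 2 * φ x * pdN l φ x * b x) * a l x -
      (φ x ^ 2 * a i x + 2 * φ x * pdN i φ x * b x) * c l x) (nuHalfBall ν R) := fun l =>
    integrableOn_nuHalfBall (hXc l) hR
  have hb2 : IntegrableOn (fun x => b x ^ 2) (nuHalfBall ν R) :=
    integrableOn_nuHalfBall (hcb.pow 2) hR
  have hf2 : IntegrableOn (fun x => f x ^ 2) (nuHalfBall ν R) :=
    integrableOn_nuHalfBall (hfc.pow 2) hR
  have ha2 : IntegrableOn (fun x => φ x ^ 2 * a j x ^ 2) (nuHalfBall ν R) :=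
    integrableOn_nuHalfBall ((hφc.pow 2).mul ((hac j).pow 2)) hR
  have hgrad : ∀ x, ∑ l, pdN l φ x ^ 2 ≤ n * (4 * C) ^ 2 * (R - r)⁻¹ ^ 2 := by
    intro x
    have hle : ∀ l ∈ Finset.univ, pdN l φ x ^ 2 ≤ (4 * C) ^ 2 * (R - r)⁻¹ ^ 2 := by
      intro l _
      have h := abs_pdN_radialCutoff_le hC0 hC hr h1 l x
      have he : 2 * C / (R₁ - r) = 4 * C * (R - r)⁻¹ := by
        have : R - r ≠ 0 := by linarith
        rw [hR₁, show (r + R) / 2 - r = (R - r) / 2 by ring]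
        field_simp
        ring
      rw [← mul_pow, ← sq_abs, ← he]
      exact pow_le_pow_left₀ (abs_nonneg _) h 2
    have := Finset.sum_le_card_nsmul Finset.univ (fun l => pdN l φ x ^ 2) _ hle
    simpa [mul_assoc] using this
  have hpt : ∀ x, φ x ^ 2 * a j x ^ 2 ≤
      4 * ∑ l, ((φ x ^ 2 * a l x + 2 * φ x * pdN l φ x * b x) * a l x -
      (φ x ^ 2 * a i x + 2 * φ x * pdN i φ x * b x) * c l x) +
      12 * (n * (4 * C) ^ 2 * (R - r)⁻¹ ^ 2) * b x ^ 2 + 8 * f x ^ 2 := by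
    intro x
    have h := energy_pointwise (φ x) (b x) (fun l => a l x) (fun l => c l x)
      (fun l => pdN l φ x) i j
    have h3 := mul_le_mul_of_nonneg_right (hgrad x) (sq_nonneg (b x))
    have h4 : φ x ^ 2 * f x ^ 2 ≤ f x ^ 2 := by
      have := radialCutoff_mem_Icc (r := r) (R := R₁) x
      exact mul_le_of_le_one_left (sq_nonneg _) (pow_le_one₀ this.1 this.2)
    linarith
  have hI1 : ∫ x in nuHalfBall ν r, a j x ^ 2 ≤ ∫ x in nuHalfBall ν R, φ x ^ 2 * a j x ^ 2 := by
    have : ∫ x in nuHalfBall ν r, a j x ^ 2 = ∫ x in nuHalfBall ν r, φ x ^ 2 * a j x ^ 2 := by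
      refine setIntegral_congr_fun (measurableSet_nuHalfBall ν r) fun x hx => ?_
      rw [hφ, radialCutoff_eq_one hr h1 hx.1.le]
      ring
    rw [this]
    exact setIntegral_mono_set ha2 (ae_of_all _ fun x => by positivity)
      (nuHalfBall_mono ν hrR.le).eventuallyLE
  have hS : IntegrableOn (fun x => 4 * ∑ l, ((φ x ^ 2 * a l x + 2 * φ x * pdN l φ x * b x) * a l x -
      (φ x ^ 2 * a i x + 2 * φ x * pdN i φ x * b x) * c l x)) (nuHalfBall ν R) :=
    (integrable_finsetSum _ fun l _ => hXint l).const_mul 4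
  have hT : IntegrableOn (fun x => 12 * (n * (4 * C) ^ 2 * (R - r)⁻¹ ^ 2) * b x ^ 2)
      (nuHalfBall ν R) := hb2.const_mul _
  have hI2 := integral_mono ha2 ((hS.add hT).add (hf2.const_mul 8)) hpt
  rw [integral_add' (hS.add hT) (hf2.const_mul 8), integral_add' hS hT, integral_const_mul,
    integral_const_mul, integral_const_mul, integral_finsetSum _ fun l _ => hXint l] at hI2
  simp only [hX0, Finset.sum_const_zero, mul_zero, zero_add] at hI2
  have hB : 0 ≤ (R - r)⁻¹ ^ 2 * ∫ x in nuHalfBall ν R, b x ^ 2 :=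
    mul_nonneg (sq_nonneg _) (integral_nonneg fun x => sq_nonneg _)
  have hF : 0 ≤ ∫ x in nuHalfBall ν R, f x ^ 2 := integral_nonneg fun x => sq_nonneg _
  have hN : (0 : ℝ) ≤ n * (4 * C) ^ 2 := by positivity
  have := mul_nonneg hN hF
  nlinarith [hI1, hI2]

end Energy

section Words

/-- Iterated partial derivatives within `K` along a word of coordinate directions. -/
def dWord (K : Set (Eu n)) (L : List (Fin n)) (v : Eu n → ℝ) : Eu n → ℝ :=
  L.foldr (pdWithin K) v

/-- The Laplacian within `K`. -/
def lapWithin (K : Set (Eu n)) (v : Eu n → ℝ) : Eu n → ℝ :=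
  fun x => ∑ i, pdWithin K i (pdWithin K i v) x

variable {K : Set (Eu n)}

lemma contDiffOn_dWord (hK : UniqueDiffOn ℝ K) (L : List (Fin n)) {q : ℕ} {v : Eu n → ℝ}
    (hv : ContDiffOn ℝ (q + L.length : ℕ) v K) : ContDiffOn ℝ q (dWord K L v) K := by
  induction L generalizing q with
  | nil => exact hv
  | cons i L ih =>
    refine contDiffOn_pdWithin hK (ih (q := q + 1) (hv.of_le ?_)) i
    rw [List.length_cons, add_right_comm, add_assoc]

lemma dWord_append (L₁ L₂ : List (Fin n)) (v : Eu n → ℝ) :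
    dWord K (L₁ ++ L₂) v = dWord K L₁ (dWord K L₂ v) :=
  List.foldr_append ..

lemma dWord_perm (hK : UniqueDiffOn ℝ K) (hint : K ⊆ closure (interior K)) {L₁ L₂ : List (Fin n)}
    (h : L₁.Perm L₂) {v : Eu n → ℝ} (hv : ContDiffOn ℝ L₁.length v K) :
    Set.EqOn (dWord K L₁ v) (dWord K L₂ v) K := by
  induction h with
  | nil => exact fun _ _ => rfl
  | cons i _ ih => exact pdWithin_congr (ih (hv.of_le (by simp))) i
  | swap i j L =>
    refine pdWithin_comm hK hint (contDiffOn_dWord hK L (q := 2) (hv.of_le ?_)) _ _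
    simp only [List.length_cons]
    norm_cast
    omega
  | trans h₁ _ ih₁ ih₂ =>
    exact (ih₁ hv).trans (ih₂ (by rwa [← h₁.length_eq]))

lemma pdWithin_sum (hK : UniqueDiffOn ℝ K) {ι : Type*} (s : Finset ι) {f : ι → Eu n → ℝ}
    (hf : ∀ i ∈ s, DifferentiableOn ℝ (f i) K) (j : Fin n) :
    Set.EqOn (pdWithin K j fun x => ∑ i ∈ s, f i x) (fun x => ∑ i ∈ s, pdWithin K j (f i) x)
      K := by
  intro x hx
  simp only [pdWithin]
  rw [fderivWithin_fun_sum (hK x hx) fun i hi => hf i hi x hx]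
  simp

lemma dWord_sum (hK : UniqueDiffOn ℝ K) {ι : Type*} (s : Finset ι) {f : ι → Eu n → ℝ}
    (L : List (Fin n)) (hf : ∀ i ∈ s, ContDiffOn ℝ L.length (f i) K) :
    Set.EqOn (dWord K L fun x => ∑ i ∈ s, f i x) (fun x => ∑ i ∈ s, dWord K L (f i) x) K := by
  induction L with
  | nil => exact fun _ _ => rfl
  | cons j L ih =>
    refine (pdWithin_congr (ih fun i hi => (hf i hi).of_le (by simp)) j).trans ?_
    refine pdWithin_sum hK s (fun i hi => ?_) j
    refine (contDiffOn_dWord hK L (q := 1) ((hf i hi).of_le ?_)).differentiableOn one_ne_zero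
    simp [add_comm]

/-- Derivatives along a word commute with the Laplacian. -/
lemma dWord_lapWithin (hK : UniqueDiffOn ℝ K) (hint : K ⊆ closure (interior K))
    (L : List (Fin n)) {v : Eu n → ℝ} (hv : ContDiffOn ℝ (L.length + 2 : ℕ) v K) :
    Set.EqOn (dWord K L (lapWithin K v)) (fun x => ∑ i, dWord K (i :: i :: L) v x) K := by
  have h1 := dWord_sum hK univ (f := fun i => pdWithin K i (pdWithin K i v)) L fun i _ =>
    contDiffOn_dWord hK [i, i] (q := L.length) hv
  refine h1.trans fun x hx => Finset.sum_congr rfl fun i _ => ?_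
  have h2 : dWord K L (pdWithin K i (pdWithin K i v)) = dWord K (L ++ [i, i]) v := by
    rw [dWord_append]
    rfl
  rw [h2]
  refine dWord_perm hK hint (List.perm_append_comm (l₂ := [i, i])) ?_ hx
  simpa using hv

lemma contDiffOn_lapWithin (hK : UniqueDiffOn ℝ K) {q : ℕ} {v : Eu n → ℝ}
    (hv : ContDiffOn ℝ (q + 2 : ℕ) v K) : ContDiffOn ℝ q (lapWithin K v) K :=
  ContDiffOn.sum fun i _ => contDiffOn_dWord hK [i, i] hv

lemma dWord_eq_zero_on_flat {ν : Fin n} {ρ : ℝ} (hρ : 0 < ρ) {v : Eu n → ℝ}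
    (h0 : ∀ x, ‖x‖ < ρ → x ν = 0 → v x = 0) (L : List (Fin n))
    (hv : ContDiffOn ℝ L.length v (closure (nuHalfBall ν ρ))) (hL : ν ∉ L) :
    ∀ x, ‖x‖ < ρ → x ν = 0 → dWord (closure (nuHalfBall ν ρ)) L v x = 0 := by
  induction L with
  | nil => exact h0
  | cons i L ih =>
    rw [List.mem_cons, not_or] at hL
    intro x hx hxν
    refine pdWithin_eq_zero_on_flat (Ne.symm hL.1) ?_
      (ih (hv.of_le (by simp)) hL.2) hx hxν
    refine (contDiffOn_dWord (uniqueDiffOn_closure_nuHalfBall ν hρ) L (q := 1)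
      (hv.of_le ?_)).differentiableOn one_ne_zero
    simp [add_comm]

/-- The sorted word with `α i` letters `i`. -/
def sortedWord (α : Fin n → ℕ) : List (Fin n) :=
  (List.finRange n).flatMap fun i => List.replicate (α i) i

lemma perm_sortedWord_count (L : List (Fin n)) : L.Perm (sortedWord fun i => L.count i) := by
  rw [List.perm_iff_count]
  intro a
  simp [sortedWord, List.count_flatMap, Function.comp_def, List.count_replicate,
    ← List.ofFn_eq_map, List.sum_ofFn]

lemma count_mem_antidiagonalTuple (L : List (Fin n)) :
    (fun i => L.count i) ∈ Finset.Nat.antidiagonalTuple n L.length := by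
  rw [Finset.Nat.mem_antidiagonalTuple]
  simpa using Multiset.sum_count_eq_card (s := univ) (m := (L : Multiset (Fin n))) (by simp)

lemma length_sortedWord (α : Fin n → ℕ) : (sortedWord α).length = ∑ i, α i := by
  simp [sortedWord, List.length_flatMap, ← List.ofFn_eq_map, List.sum_ofFn]

lemma mdN_eq_dWord {U : Set (Eu n)} (hU : IsOpen U) (hUK : U ⊆ K) {v w : Eu n → ℝ}
    (h : Set.EqOn v w U) (α : Fin n → ℕ) :
    Set.EqOn (mdN α v) (dWord K (sortedWord α) w) U := by
  rw [mdN, sortedWord]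
  induction List.finRange n with
  | nil => exact h
  | cons i l ih =>
    rw [List.foldr_cons, List.flatMap_cons, dWord_append]
    induction α i with
    | zero => exact ih
    | succ a iha =>
      rw [Function.iterate_succ_apply', List.replicate_succ]
      exact (pdN_congr_of_isOpen hU iha i).trans (pdWithin_eq_pdN hU hUK i _).symm

lemma lapN_eq_lapWithin {U : Set (Eu n)} (hU : IsOpen U) (hUK : U ⊆ K) (v : Eu n → ℝ) :
    Set.EqOn (lapN v) (lapWithin K v) U := by
  intro x hx
  refine Finset.sum_congr rfl fun i _ => ?_
  exact ((pdWithin_eq_pdN hU hUK i _).trans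
    (pdN_congr_of_isOpen hU (pdWithin_eq_pdN hU hUK i v) i)).symm hx

end Words

section SemiNorm

variable {ν : Fin n} {ρ R : ℝ}

lemma hSemi_nonneg (ℓ : ℕ) (V : Set (Eu n)) (v : Eu n → ℝ) : 0 ≤ hSemi ℓ V v :=
  Real.sqrt_nonneg _

lemma hSemi_sq (ℓ : ℕ) (V : Set (Eu n)) (v : Eu n → ℝ) :
    hSemi ℓ V v ^ 2 = ∑ α ∈ Finset.Nat.antidiagonalTuple n ℓ, ∫ x in V, mdN α v x ^ 2 :=
  Real.sq_sqrt (Finset.sum_nonneg fun _ _ => integral_nonneg fun _ => sq_nonneg _)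

lemma setIntegral_dWord_sq_le_hSemi_sq (hρ : 0 < ρ) {v w : Eu n → ℝ}
    (h : Set.EqOn v w (nuHalfBall ν ρ)) (L : List (Fin n))
    (hw : ContDiffOn ℝ L.length w (closure (nuHalfBall ν ρ))) :
    ∫ x in nuHalfBall ν ρ, dWord (closure (nuHalfBall ν ρ)) L w x ^ 2 ≤
      hSemi L.length (nuHalfBall ν ρ) v ^ 2 := by
  rw [hSemi_sq]
  refine le_trans (le_of_eq ?_) (Finset.single_le_sum
    (f := fun α => ∫ x in nuHalfBall ν ρ, mdN α v x ^ 2)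
    (fun _ _ => integral_nonneg fun _ => sq_nonneg _) (count_mem_antidiagonalTuple L))
  refine setIntegral_congr_fun (measurableSet_nuHalfBall ν ρ) fun x hx => ?_
  rw [mdN_eq_dWord (isOpen_nuHalfBall ν ρ) subset_closure h _ hx,
    dWord_perm (uniqueDiffOn_closure_nuHalfBall ν hρ) (subset_closure_interior_closure ν ρ)
      (perm_sortedWord_count L) hw (subset_closure hx)]

lemma hSemi_sq_le {ℓ : ℕ} {v : Eu n → ℝ} {B : ℝ} (hR : R ≤ ρ)
    (h : ∀ L : List (Fin n), L.length = ℓ →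
      ∫ x in nuHalfBall ν R, dWord (closure (nuHalfBall ν ρ)) L v x ^ 2 ≤ B) :
    hSemi ℓ (nuHalfBall ν R) v ^ 2 ≤ (Finset.Nat.antidiagonalTuple n ℓ).card * B := by
  rw [hSemi_sq, ← nsmul_eq_mul]
  refine Finset.sum_le_card_nsmul _ _ _ fun α hα => ?_
  rw [Finset.Nat.mem_antidiagonalTuple] at hα
  refine le_trans (le_of_eq ?_) (h (sortedWord α) ((length_sortedWord α).trans hα))
  refine setIntegral_congr_fun (measurableSet_nuHalfBall ν R) fun x hx => ?_
  rw [mdN_eq_dWord (isOpen_nuHalfBall ν R) ((nuHalfBall_mono ν hR).trans subset_closure)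
    (fun _ _ => rfl) _ hx]

lemma hSemi_mono {ℓ : ℕ} {v : Eu n → ℝ} (hρ : 0 < ρ) (hR : R ≤ ρ)
    (hv : ContDiffOn ℝ ℓ v (closure (nuHalfBall ν ρ))) :
    hSemi ℓ (nuHalfBall ν R) v ≤ hSemi ℓ (nuHalfBall ν ρ) v := by
  refine Real.sqrt_le_sqrt (Finset.sum_le_sum fun α hα => ?_)
  rw [Finset.Nat.mem_antidiagonalTuple, ← length_sortedWord] at hα
  refine setIntegral_mono_set ?_ (ae_of_all _ fun x => sq_nonneg _)
    (nuHalfBall_mono ν hR).eventuallyLE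
  have h1 := (contDiffOn_dWord (uniqueDiffOn_closure_nuHalfBall ν hρ) (sortedWord α) (q := 0)
    (v := v) (by simpa [hα] using hv)).continuousOn
  refine (integrableOn_nuHalfBall (h1.pow 2) le_rfl).congr_fun (fun x hx => ?_)
    (measurableSet_nuHalfBall ν ρ)
  simp only [Pi.pow_apply]
  rw [mdN_eq_dWord (isOpen_nuHalfBall ν ρ) subset_closure (fun _ _ => rfl) _ hx]

end SemiNorm

section Iteration

variable {ν : Fin n} {ρ r R : ℝ}

lemma exists_perm_cons_cons {L : List (Fin n)} (hL : 2 ≤ L.length) (hc : L.count ν ≤ 1) :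
    ∃ j i, ∃ L' : List (Fin n), L.Perm (j :: i :: L') ∧ i ≠ ν ∧ ν ∉ L' := by
  by_cases hν : ν ∈ L
  · have h1 := List.perm_cons_erase hν
    have h2 : ν ∉ L.erase ν := by
      rw [← List.count_eq_zero, List.count_erase_self]
      omega
    have h3 := h1.length_eq
    match hE : L.erase ν with
    | [] =>
      rw [hE, List.length_singleton] at h3
      omega
    | i :: L' =>
      rw [hE] at h1 h2
      rw [List.mem_cons, not_or] at h2
      exact ⟨ν, i, L', h1, Ne.symm h2.1, h2.2⟩
  · match L, hL with
    | j :: i :: L', _ =>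
      simp only [List.mem_cons, not_or] at hν
      exact ⟨j, i, L', List.Perm.refl _, Ne.symm hν.2.1, hν.2.2⟩

lemma integrableOn_dWord_sq (hρ : 0 < ρ) (hR : R ≤ ρ) (L : List (Fin n)) {v : Eu n → ℝ}
    (hv : ContDiffOn ℝ L.length v (closure (nuHalfBall ν ρ))) :
    IntegrableOn (fun x => dWord (closure (nuHalfBall ν ρ)) L v x ^ 2) (nuHalfBall ν R) :=
  integrableOn_nuHalfBall ((contDiffOn_dWord (uniqueDiffOn_closure_nuHalfBall ν hρ) L (q := 0)
    (by simpa using hv)).continuousOn.pow 2) hR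

lemma setIntegral_dWord_perm (hρ : 0 < ρ) (hR : R ≤ ρ) {L₁ L₂ : List (Fin n)} (h : L₁.Perm L₂)
    {v : Eu n → ℝ} (hv : ContDiffOn ℝ L₁.length v (closure (nuHalfBall ν ρ))) :
    ∫ x in nuHalfBall ν R, dWord (closure (nuHalfBall ν ρ)) L₁ v x ^ 2 =
      ∫ x in nuHalfBall ν R, dWord (closure (nuHalfBall ν ρ)) L₂ v x ^ 2 := by
  refine setIntegral_congr_fun (measurableSet_nuHalfBall ν R) fun x hx => ?_
  rw [dWord_perm (uniqueDiffOn_closure_nuHalfBall ν hρ) (subset_closure_interior_closure ν ρ)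
    h hv (subset_closure (nuHalfBall_mono ν hR hx))]

lemma setIntegral_dWord_sq_le_hSemi_sq_of_le (hρ : 0 < ρ) (hR : R ≤ ρ) {v w : Eu n → ℝ}
    (h : Set.EqOn v w (nuHalfBall ν ρ)) (L : List (Fin n))
    (hw : ContDiffOn ℝ L.length w (closure (nuHalfBall ν ρ))) :
    ∫ x in nuHalfBall ν R, dWord (closure (nuHalfBall ν ρ)) L w x ^ 2 ≤
      hSemi L.length (nuHalfBall ν ρ) v ^ 2 :=
  (setIntegral_mono_set (integrableOn_dWord_sq hρ le_rfl L hw) (ae_of_all _ fun _ => sq_nonneg _)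
    (nuHalfBall_mono ν hR).eventuallyLE).trans (setIntegral_dWord_sq_le_hSemi_sq hρ h L hw)

/-- One step of the interior-type estimate for derivatives with at most one normal direction. -/
lemma exists_tangential_step (n : ℕ) : ∃ C : ℝ, 1 ≤ C ∧ ∀ (ν : Fin n) (ρ r R : ℝ) (u : Eu n → ℝ)
    (p : ℕ) (M G : ℝ), 0 ≤ r → r < R → R ≤ ρ → 0 ≤ M → 0 ≤ G →
    ContDiffOn ℝ (p + 2 : ℕ) u (closure (nuHalfBall ν ρ)) →
    (∀ x, ‖x‖ < ρ → x ν = 0 → u x = 0) →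
    (∀ L : List (Fin n), L.length = p + 1 → L.count ν ≤ 1 →
      ∫ x in nuHalfBall ν R, dWord (closure (nuHalfBall ν ρ)) L u x ^ 2 ≤ M ^ 2) →
    (∀ L : List (Fin n), L.length = p →
      ∫ x in nuHalfBall ν R, dWord (closure (nuHalfBall ν ρ)) L
        (lapWithin (closure (nuHalfBall ν ρ)) u) x ^ 2 ≤ G ^ 2) →
    ∀ L : List (Fin n), L.length = p + 2 → L.count ν ≤ 1 →
      ∫ x in nuHalfBall ν r, dWord (closure (nuHalfBall ν ρ)) L u x ^ 2 ≤
        (C * (G + (R - r)⁻¹ * M)) ^ 2 := by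
  obtain ⟨C, hC, hE⟩ := exists_energy_estimate n
  refine ⟨C, hC, fun ν ρ r R u p M G hr hrR hR hM hG hu hu0 hbM hbG L hL hc => ?_⟩
  have hρ : 0 < ρ := by linarith
  have hKu := uniqueDiffOn_closure_nuHalfBall ν hρ
  obtain ⟨j, i, L', hp, hi, hν⟩ := exists_perm_cons_cons (by omega) hc
  have hL' : L'.length = p := by
    have := hp.length_eq
    simp only [List.length_cons] at this
    omega
  rw [setIntegral_dWord_perm hρ (hrR.le.trans hR) hp (by rwa [hL])]
  have hE' := hE ν i j ρ r R (dWord (closure (nuHalfBall ν ρ)) L' u) hi hr hrR hR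
    (contDiffOn_dWord hKu L' (q := 2) (hu.of_le (by norm_cast; omega)))
    (dWord_eq_zero_on_flat hρ hu0 L' (hu.of_le (by norm_cast; omega)) hν)
  have h1 : ∫ x in nuHalfBall ν R, (∑ l, pdWithin (closure (nuHalfBall ν ρ)) l
      (pdWithin (closure (nuHalfBall ν ρ)) l (dWord (closure (nuHalfBall ν ρ)) L' u)) x) ^ 2 ≤
      G ^ 2 := by
    refine le_trans (le_of_eq ?_) (hbG L' hL')
    refine setIntegral_congr_fun (measurableSet_nuHalfBall ν R) fun x hx => ?_
    rw [dWord_lapWithin hKu (subset_closure_interior_closure ν ρ) L' (by rwa [hL'])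
      (subset_closure (nuHalfBall_mono ν hR hx))]
    rfl
  have h2 := hbM (i :: L') (by simp [hL']) (by
    rw [List.count_cons_of_ne hi, List.count_eq_zero.2 hν]
    exact zero_le_one)
  have hd : 0 < (R - r)⁻¹ := inv_pos.2 (by linarith)
  calc _ ≤ C * (G ^ 2 + (R - r)⁻¹ ^ 2 * M ^ 2) := hE'.trans (by gcongr; exact h2)
    _ ≤ C * (G + (R - r)⁻¹ * M) ^ 2 := by
      gcongr
      nlinarith [mul_nonneg hG (mul_nonneg hd.le hM)]
    _ ≤ C ^ 2 * (G + (R - r)⁻¹ * M) ^ 2 := by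
      gcongr
      nlinarith
    _ = _ := by ring

/-- Bound for derivatives of order `p + 1 + q` with at most one normal direction, obtained from
`q` steps of width `d`. -/
lemma exists_tangential_bound (n : ℕ) : ∃ C : ℝ, 1 ≤ C ∧ ∀ (ν : Fin n) (ρ d : ℝ) (u : Eu n → ℝ)
    (p q : ℕ), 0 < d → q * d < ρ →
    ContDiffOn ℝ (p + 1 + q : ℕ) u (closure (nuHalfBall ν ρ)) →
    (∀ x, ‖x‖ < ρ → x ν = 0 → u x = 0) →
    ∀ L : List (Fin n), L.length = p + 1 + q → L.count ν ≤ 1 →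
      ∫ x in nuHalfBall ν (ρ - q * d), dWord (closure (nuHalfBall ν ρ)) L u x ^ 2 ≤
        (C * ∑ s ∈ range q, (C / d) ^ (q - 1 - s) * hSemi (p + s) (nuHalfBall ν ρ) (lapN u) +
          (C / d) ^ q * hSemi (p + 1) (nuHalfBall ν ρ) u) ^ 2 := by
  obtain ⟨C, hC, hS⟩ := exists_tangential_step n
  refine ⟨C, hC, fun ν ρ d u p q hd => ?_⟩
  have hG : ∀ ℓ, 0 ≤ hSemi ℓ (nuHalfBall ν ρ) (lapN u) := fun ℓ => hSemi_nonneg _ _ _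
  have hm := hSemi_nonneg (p + 1) (nuHalfBall ν ρ) u
  induction q with
  | zero =>
    intro hq hu hu0 L hL _
    have hρ : 0 < ρ := by simpa using hq
    have h1 := setIntegral_dWord_sq_le_hSemi_sq hρ (fun _ _ => rfl) L (hu.of_le (by rw [hL]))
    rw [hL] at h1
    simpa using h1
  | succ q ih =>
    intro hq hu hu0 L hL hc
    have hq' : ((q + 1 : ℕ) : ℝ) * d = q * d + d := by
      push_cast
      ring
    have hqd : 0 ≤ q * d := by positivity
    have hρ : 0 < ρ := by linarith
    have hnonneg : 0 ≤ ∑ s ∈ range q, (C / d) ^ (q - 1 - s) *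
        hSemi (p + s) (nuHalfBall ν ρ) (lapN u) :=
      Finset.sum_nonneg fun s _ => mul_nonneg (by positivity) (hG _)
    refine (hS ν ρ (ρ - (q + 1 : ℕ) * d) (ρ - q * d) u (p + q)
      (C * ∑ s ∈ range q, (C / d) ^ (q - 1 - s) * hSemi (p + s) (nuHalfBall ν ρ) (lapN u) +
          (C / d) ^ q * hSemi (p + 1) (nuHalfBall ν ρ) u)
      (hSemi (p + q) (nuHalfBall ν ρ) (lapN u)) (by linarith) (by linarith) (by linarith)
      (by positivity) (hG _) (hu.of_le (by norm_cast; omega)) hu0 (fun L' hL' hc' =>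
        ih (by linarith) (hu.of_le (by norm_cast; omega)) hu0 L' (by omega) hc')
      (fun L' hL' => ?_) L (by omega) hc).trans (le_of_eq ?_)
    · rw [← hL']
      exact setIntegral_dWord_sq_le_hSemi_sq_of_le hρ (by linarith)
        (lapN_eq_lapWithin (isOpen_nuHalfBall ν ρ) subset_closure u) L'
        (contDiffOn_lapWithin (uniqueDiffOn_closure_nuHalfBall ν hρ)
          (hu.of_le (by norm_cast; omega)))
    · have h1 : ρ - q * d - (ρ - (q + 1 : ℕ) * d) = d := by
        rw [hq']
        ring
      have h2 : ∀ s ∈ range q, (C / d) ^ (q + 1 - 1 - s) =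
          (C / d) * (C / d) ^ (q - 1 - s) := by
        intro s hs
        rw [← pow_succ']
        congr 1
        have := Finset.mem_range.1 hs
        omega
      have h3 : ∑ s ∈ range q, (C / d) ^ (q + 1 - 1 - s) * hSemi (p + s) (nuHalfBall ν ρ) (lapN u) =
          (C / d) * ∑ s ∈ range q, (C / d) ^ (q - 1 - s) *
            hSemi (p + s) (nuHalfBall ν ρ) (lapN u) := by
        rw [Finset.mul_sum]
        exact Finset.sum_congr rfl fun s hs => by rw [h2 s hs, mul_assoc]
      rw [h1, Finset.sum_range_succ, h3, Nat.add_sub_cancel, Nat.sub_self, pow_zero, pow_succ,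
        div_eq_mul_inv]
      ring

/-- Normal derivatives are recovered from the Laplacian and tangential derivatives. -/
lemma setIntegral_dWord_sq_le_of_normal (hρ : 0 < ρ) (hR : R ≤ ρ) {u : Eu n → ℝ} {k : ℕ}
    (hu : ContDiffOn ℝ k u (closure (nuHalfBall ν ρ))) {B : ℝ} (hB : 0 ≤ B)
    (hbT : ∀ L : List (Fin n), L.length = k → L.count ν ≤ 1 →
      ∫ x in nuHalfBall ν R, dWord (closure (nuHalfBall ν ρ)) L u x ^ 2 ≤ B)
    (hbG : ∀ L : List (Fin n), L.length + 2 = k →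
      ∫ x in nuHalfBall ν R, dWord (closure (nuHalfBall ν ρ)) L
        (lapWithin (closure (nuHalfBall ν ρ)) u) x ^ 2 ≤ B)
    (c : ℕ) : ∀ L : List (Fin n), L.length = k → L.count ν ≤ c →
      ∫ x in nuHalfBall ν R, dWord (closure (nuHalfBall ν ρ)) L u x ^ 2 ≤
        ((n : ℝ) ^ 2) ^ c * B := by
  have hn : (1 : ℝ) ≤ (n : ℝ) ^ 2 := one_le_pow₀ (by exact_mod_cast ν.pos)
  have hKu := uniqueDiffOn_closure_nuHalfBall ν hρ
  induction c with
  | zero => exact fun L hL hc => by simpa using hbT L hL (by omega)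
  | succ c ih =>
    intro L hL hc
    have hB1 : ∀ c : ℕ, B ≤ ((n : ℝ) ^ 2) ^ c * B := fun c =>
      le_mul_of_one_le_left hB (one_le_pow₀ hn)
    rcases Nat.lt_or_ge (L.count ν) 2 with h | h
    · exact (hbT L hL (by omega)).trans (hB1 _)
    have hp : ∃ L' : List (Fin n), L.Perm (ν :: ν :: L') := by
      have h1 := List.perm_cons_erase (List.count_pos_iff.1 (by omega : 0 < L.count ν))
      have h2 : 0 < (L.erase ν).count ν := by
        rw [List.count_erase_self]
        omega
      exact ⟨_, h1.trans ((List.perm_cons_erase (List.count_pos_iff.1 h2)).cons ν)⟩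
    obtain ⟨L', hp⟩ := hp
    have hL' : L'.length + 2 = k := by
      have := hp.length_eq
      simp only [List.length_cons] at this
      omega
    have hc' : L'.count ν + 1 ≤ c := by
      have := hp.count_eq ν
      simp only [List.count_cons_self] at this
      omega
    rw [setIntegral_dWord_perm hρ hR hp (by rwa [hL])]
    set K := closure (nuHalfBall ν ρ) with hK
    set g : Fin n → Eu n → ℝ := fun i x =>
      if i = ν then dWord K L' (lapWithin K u) x else - dWord K (i :: i :: L') u x with hg
    have hsum : ∀ x ∈ nuHalfBall ν R, dWord K (ν :: ν :: L') u x = ∑ i, g i x := by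
      intro x hx
      have h1 := dWord_lapWithin hKu (subset_closure_interior_closure ν ρ) L'
        (by rwa [hL']) (subset_closure (nuHalfBall_mono ν hR hx))
      simp only at h1
      rw [← Finset.add_sum_erase _ _ (Finset.mem_univ ν)] at h1 ⊢
      have h2 : ∑ i ∈ univ.erase ν, g i x = - ∑ i ∈ univ.erase ν, dWord K (i :: i :: L') u x := by
        rw [← Finset.sum_neg_distrib]
        exact Finset.sum_congr rfl fun i hi => if_neg (Finset.ne_of_mem_erase hi)
      have h3 : g ν x = dWord K L' (lapWithin K u) x := if_pos rfl
      rw [h2, h3, h1]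
      ring
    have hlap : ContDiffOn ℝ L'.length (lapWithin K u) K :=
      contDiffOn_lapWithin hKu (by rwa [hL'])
    have hgi : ∀ i, IntegrableOn (fun x => g i x ^ 2) (nuHalfBall ν R) := by
      intro i
      by_cases hi : i = ν
      · simp only [hg, hi, if_true]
        exact integrableOn_dWord_sq hρ hR L' hlap
      · simp only [hg, hi, if_false, neg_sq]
        exact integrableOn_dWord_sq hρ hR (i :: i :: L') (by simpa [hL'] using hu)
    have hgb : ∀ i, ∫ x in nuHalfBall ν R, g i x ^ 2 ≤ ((n : ℝ) ^ 2) ^ c * B := by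
      intro i
      by_cases hi : i = ν
      · simp only [hg, hi, if_true]
        exact (hbG L' hL').trans (hB1 _)
      · simp only [hg, hi, if_false, neg_sq]
        refine ih (i :: i :: L') (by simpa using hL') ?_
        rw [List.count_cons_of_ne hi, List.count_cons_of_ne hi]
        omega
    calc ∫ x in nuHalfBall ν R, dWord K (ν :: ν :: L') u x ^ 2
        = ∫ x in nuHalfBall ν R, (∑ i, g i x) ^ 2 :=
          setIntegral_congr_fun (measurableSet_nuHalfBall ν R) fun x hx => by rw [hsum x hx]
      _ ≤ ∫ x in nuHalfBall ν R, n * ∑ i, g i x ^ 2 := by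
          refine integral_mono_of_nonneg (ae_of_all _ fun _ => sq_nonneg _)
            ((integrable_finsetSum _ fun i _ => hgi i).const_mul _) (ae_of_all _ fun x => ?_)
          simpa using sq_sum_le_card_mul_sum_sq (s := univ) (f := fun i => g i x)
      _ = n * ∑ i, ∫ x in nuHalfBall ν R, g i x ^ 2 := by
          rw [integral_const_mul, integral_finsetSum _ fun i _ => hgi i]
      _ ≤ n * ∑ _i : Fin n, ((n : ℝ) ^ 2) ^ c * B := by
          gcongr with i
          exact hgb i
      _ = ((n : ℝ) ^ 2) ^ (c + 1) * B := by
          simp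
          ring

lemma card_antidiagonalTuple_le (n k : ℕ) :
    (Finset.Nat.antidiagonalTuple n k).card ≤ (2 ^ n) ^ k := by
  have h1 : Finset.Nat.antidiagonalTuple n k ⊆
      Fintype.piFinset fun _ : Fin n => range (k + 1) := by
    intro α hα
    rw [Finset.Nat.mem_antidiagonalTuple] at hα
    rw [Fintype.mem_piFinset]
    intro i
    rw [Finset.mem_range, Nat.lt_succ_iff, ← hα]
    exact Finset.single_le_sum (fun _ _ => Nat.zero_le _) (Finset.mem_univ i)
  calc _ ≤ (k + 1) ^ n := by simpa using Finset.card_le_card h1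
    _ ≤ (2 ^ k) ^ n := Nat.pow_le_pow_left Nat.lt_two_pow_self n
    _ = (2 ^ n) ^ k := by rw [← pow_mul, ← pow_mul, mul_comm]

lemma pow_mul_factorial_le {k j : ℕ} (hj : j ≤ k) :
    (k : ℝ) ^ j * (k - j).factorial ≤ exp 1 ^ k * k.factorial := by
  have h1 := pow_div_factorial_le_exp (k : ℝ) (Nat.cast_nonneg k) j
  rw [div_le_iff₀ (by positivity)] at h1
  have h2 : (j.factorial * (k - j).factorial : ℝ) ≤ k.factorial := by
    exact_mod_cast Nat.le_of_dvd k.factorial_pos (Nat.factorial_mul_factorial_dvd_factorial hj)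
  rw [← exp_nat_mul, mul_one]
  calc (k : ℝ) ^ j * (k - j).factorial ≤ exp k * j.factorial * (k - j).factorial := by gcongr
    _ = exp k * (j.factorial * (k - j).factorial) := by ring
    _ ≤ exp k * k.factorial := by gcongr

end Iteration

section Assembly

lemma pow_mul_factorial_le_of_le {x a : ℝ} {k j ℓ : ℕ} (hx : 0 ≤ x) (ha : 1 ≤ a)
    (hxa : x ≤ a * k) (hj : j + ℓ ≤ k) :
    x ^ j * ℓ.factorial ≤ (a * exp 1) ^ k * k.factorial := by
  have h1 : (ℓ.factorial : ℝ) ≤ (k - j).factorial := by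
    exact_mod_cast Nat.factorial_le (by omega)
  calc x ^ j * ℓ.factorial ≤ (a * k) ^ j * (k - j).factorial := by gcongr
    _ = a ^ j * (k ^ j * (k - j).factorial) := by ring
    _ ≤ a ^ k * (exp 1 ^ k * k.factorial) := by
      gcongr ?_ * ?_
      · exact pow_le_pow_right₀ ha (by omega)
      · exact pow_mul_factorial_le (by omega)
    _ = _ := by ring

lemma exists_nuHalfBall_estimate (ν : Fin n) {δ : ℝ} (hδ : 0 < δ) (p : ℕ) :
    ∃ A : ℝ, 0 < A ∧ ∀ k : ℕ, p + 1 ≤ k → ∀ u : Eu n → ℝ,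
      ContDiffOn ℝ k u (closure (nuHalfBall ν (1 + δ))) →
      (∀ x, ‖x‖ < 1 + δ → x ν = 0 → u x = 0) →
      (k.factorial : ℝ)⁻¹ * hSemi k (nuHalfBall ν 1) u ≤
        A ^ (k + 1) *
          ((∑ ℓ ∈ Ico p (k - 1),
              (ℓ.factorial : ℝ)⁻¹ * hSemi ℓ (nuHalfBall ν (1 + δ)) (lapN u)) +
            hSemi (p + 1) (nuHalfBall ν (1 + δ)) u) := by
  obtain ⟨C, hC, hT⟩ := exists_tangential_bound n
  have hC0 : 0 < C := by linarith
  have hn : (1 : ℝ) ≤ n := by exact_mod_cast ν.pos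
  set E : ℝ := 2 ^ n * n with hE
  set a : ℝ := max 1 (C / δ) with ha
  have hE1 : 1 ≤ E := one_le_mul_of_one_le_of_one_le (one_le_pow₀ one_le_two) hn
  have ha1 : 1 ≤ a := le_max_left _ _
  have he1 : 1 ≤ exp 1 := one_le_exp zero_le_one
  have hX1 : 1 ≤ E * (a * exp 1) :=
    one_le_mul_of_one_le_of_one_le hE1 (one_le_mul_of_one_le_of_one_le ha1 he1)
  have hA1 : 1 ≤ C * (E * (a * exp 1)) := one_le_mul_of_one_le_of_one_le hC hX1
  refine ⟨C * (E * (a * exp 1)), by linarith, fun k hk u hu hu0 => ?_⟩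
  have hρ : 0 < 1 + δ := by linarith
  have hρ1 : 1 ≤ 1 + δ := by linarith
  obtain ⟨N, rfl⟩ := Nat.exists_eq_add_of_le hk
  set k := p + 1 + N with hk'
  set G : ℕ → ℝ := fun ℓ => hSemi ℓ (nuHalfBall ν (1 + δ)) (lapN u) with hG
  set h := hSemi (p + 1) (nuHalfBall ν (1 + δ)) u with hh
  have hG0 : ∀ ℓ, 0 ≤ G ℓ := fun ℓ => hSemi_nonneg _ _ _
  have hh0 : 0 ≤ h := hSemi_nonneg _ _ _
  have hsum : ∑ ℓ ∈ Ico p (k - 1), (ℓ.factorial : ℝ)⁻¹ * G ℓ =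
      ∑ s ∈ range N, ((p + s).factorial : ℝ)⁻¹ * G (p + s) := by
    rw [Finset.sum_Ico_eq_sum_range, show k - 1 - p = N by omega]
  rw [hsum]
  set S := ∑ s ∈ range N, ((p + s).factorial : ℝ)⁻¹ * G (p + s) + h with hS
  have hS0 : 0 ≤ S := add_nonneg
    (Finset.sum_nonneg fun s _ => mul_nonneg (by positivity) (hG0 _)) hh0
  rcases Nat.eq_zero_or_pos N with hN | hN
  · have h1 : hSemi k (nuHalfBall ν 1) u ≤ S := by
      refine (hSemi_mono hρ hρ1 hu).trans (le_of_eq ?_)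
      simp [hS, hh, hk', hN]
    have h2 : (k.factorial : ℝ)⁻¹ ≤ 1 :=
      inv_le_one_of_one_le₀ (by exact_mod_cast k.factorial_pos)
    calc _ ≤ 1 * S := mul_le_mul h2 h1 (hSemi_nonneg _ _ _) zero_le_one
      _ ≤ _ := by
        gcongr
        exact one_le_pow₀ hA1
  have hN0 : (0 : ℝ) < N := by exact_mod_cast hN
  set D := C / (δ / N) with hD
  have hD0 : 0 ≤ D := by positivity
  have hDa : D ≤ a * k := by
    have h1 : D = C / δ * N := by
      rw [hD]
      field_simp
    rw [h1]
    refine mul_le_mul (le_max_right _ _) ?_ hN0.le (by linarith)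
    exact_mod_cast (by omega : N ≤ k)
  have hNd : (N : ℝ) * (δ / N) = δ := by field_simp
  have hT' := hT ν (1 + δ) (δ / N) u p N (by positivity) (by linarith) hu hu0
  rw [hNd, add_sub_cancel_right] at hT'
  set M := C * ∑ s ∈ range N, D ^ (N - 1 - s) * G (p + s) + D ^ N * h with hM
  have hterm : ∀ s, 0 ≤ D ^ (N - 1 - s) * G (p + s) := fun s => mul_nonneg (by positivity) (hG0 _)
  have hM0 : 0 ≤ M := add_nonneg (mul_nonneg hC0.le (Finset.sum_nonneg fun s _ => hterm s))
    (by positivity)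
  have hGM : G (p + (N - 1)) ≤ M := by
    have h1 := Finset.single_le_sum (f := fun s => D ^ (N - 1 - s) * G (p + s))
      (fun s _ => hterm s) (Finset.mem_range.2 (Nat.sub_lt hN one_pos))
    rw [Nat.sub_self, pow_zero, one_mul] at h1
    have h2 : 0 ≤ D ^ N * h := by positivity
    nlinarith [hG0 (p + (N - 1))]
  have hnormal : ∀ L : List (Fin n), L.length = k →
      ∫ x in nuHalfBall ν 1, dWord (closure (nuHalfBall ν (1 + δ))) L u x ^ 2 ≤
        ((n : ℝ) ^ 2) ^ k * M ^ 2 := by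
    intro L hL
    refine setIntegral_dWord_sq_le_of_normal hρ hρ1 hu (sq_nonneg M) hT' (fun L' hL' => ?_) k L hL
      (hL ▸ List.count_le_length)
    have h1 := setIntegral_dWord_sq_le_hSemi_sq_of_le hρ hρ1
      (lapN_eq_lapWithin (isOpen_nuHalfBall ν (1 + δ)) subset_closure u) L'
      (contDiffOn_lapWithin (uniqueDiffOn_closure_nuHalfBall ν hρ) (by rwa [hL']))
    rw [show L'.length = p + (N - 1) by omega] at h1
    exact h1.trans (pow_le_pow_left₀ (hG0 _) hGM 2)
  have hcard : ((Finset.Nat.antidiagonalTuple n k).card : ℝ) ≤ (2 ^ n) ^ k := by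
    exact_mod_cast card_antidiagonalTuple_le n k
  have h2n : (1 : ℝ) ≤ (2 ^ n) ^ k := one_le_pow₀ (one_le_pow₀ one_le_two)
  have hfin : hSemi k (nuHalfBall ν 1) u ≤ E ^ k * M := by
    rw [← pow_le_pow_iff_left₀ (hSemi_nonneg _ _ _) (by positivity) two_ne_zero]
    calc _ ≤ _ := hSemi_sq_le hρ1 hnormal
      _ ≤ ((2 ^ n) ^ k * (2 ^ n) ^ k) * (((n : ℝ) ^ 2) ^ k * M ^ 2) := by
        gcongr
        nlinarith
      _ = (E ^ k * M) ^ 2 := by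
        rw [hE]
        ring
  have hMS : M ≤ C * ((a * exp 1) ^ k * k.factorial * S) := by
    have h1 : ∀ s ∈ range N, D ^ (N - 1 - s) * G (p + s) ≤
        (a * exp 1) ^ k * k.factorial * (((p + s).factorial : ℝ)⁻¹ * G (p + s)) := by
      intro s hs
      have hs' := Finset.mem_range.1 hs
      have h2 := pow_mul_factorial_le_of_le hD0 ha1 hDa
        (j := N - 1 - s) (ℓ := p + s) (by omega)
      rw [← mul_assoc]
      refine mul_le_mul_of_nonneg_right ?_ (hG0 _)
      rwa [← div_eq_mul_inv, le_div_iff₀ (by positivity)]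
    have h3 : D ^ N ≤ (a * exp 1) ^ k * k.factorial := by
      simpa using pow_mul_factorial_le_of_le hD0 ha1 hDa (j := N) (ℓ := 0) (by omega)
    have h4 : D ^ N * h ≤ C * ((a * exp 1) ^ k * k.factorial * h) :=
      (mul_le_mul_of_nonneg_right h3 hh0).trans (le_mul_of_one_le_left (by positivity) hC)
    calc M ≤ C * ∑ s ∈ range N, (a * exp 1) ^ k * k.factorial *
          (((p + s).factorial : ℝ)⁻¹ * G (p + s)) + C * ((a * exp 1) ^ k * k.factorial * h) :=
        add_le_add (mul_le_mul_of_nonneg_left (Finset.sum_le_sum h1) hC0.le) h4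
      _ = _ := by
        rw [← Finset.mul_sum, hS]
        ring
  calc (k.factorial : ℝ)⁻¹ * hSemi k (nuHalfBall ν 1) u
      ≤ (k.factorial : ℝ)⁻¹ * (E ^ k * (C * ((a * exp 1) ^ k * k.factorial * S))) := by
        gcongr
        exact hfin.trans (by gcongr)
    _ = C * (E * (a * exp 1)) ^ k * S := by
        have : (k.factorial : ℝ) ≠ 0 := by positivity
        field_simp
        ring
    _ ≤ (C * (E * (a * exp 1))) ^ (k + 1) * S := by
        gcongr
        rw [mul_pow C]
        gcongr ?_ * ?_
        · exact le_self_pow₀ hC (by omega)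
        · exact pow_le_pow_right₀ hX1 (by omega)

end Assembly

/-- **Local Cauchy-type (finite analytic) estimate with semi-norm control on half-balls,
Dirichlet condition on the flat boundary part.** -/
theorem halfBall_dirichlet_seminorm_analytic_estimate
    (n : ℕ) (hn : 2 ≤ n) (δ : ℝ) (hδ : 0 < δ) (m : ℕ) (hm : 1 ≤ m) :
    ∃ A : ℝ, 0 < A ∧ ∀ k : ℕ, m ≤ k → ∀ u : EuclideanSpace ℝ (Fin n) → ℝ,
      ContDiffOn ℝ k u (closure (halfBall n (by omega) (1 + δ))) →
      MemHk k (halfBall n (by omega) (1 + δ)) u →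
      (∀ x ∈ flatPart n (by omega) (1 + δ), u x = 0) →
      ((Nat.factorial k : ℝ))⁻¹ * hSemi k (halfBall n (by omega) 1) u ≤
        A ^ (k + 1) *
          ((∑ ℓ ∈ Finset.Ico (m - 1) (k - 1),
              ((Nat.factorial ℓ : ℝ))⁻¹ * hSemi ℓ (halfBall n (by omega) (1 + δ)) (lapN u)) +
            hSemi m (halfBall n (by omega) (1 + δ)) u) := by
  obtain ⟨p, rfl⟩ := Nat.exists_eq_add_of_le' hm
  obtain ⟨A, hA, h⟩ := exists_nuHalfBall_estimate (⟨n - 1, by omega⟩ : Fin n) hδ p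
  refine ⟨A, hA, fun k hk u hu _ hu0 => ?_⟩
  rw [Nat.add_sub_cancel]
  exact h k hk u hu fun x hx hxν => hu0 x ⟨hx, hxν⟩
end
end

section
/- Assume the edge a priori estimate holds for β and ε. Let R ∈ [0, ε) and ρ ∈ (0, ε−R]. If u ∈ K²_β(W_{R+ρ}) solves Δu = f in W_{R+ρ} with u = 0 on the two faces and f ∈ K⁰_{β+2}(W_{R+ρ}), then there exists a constant C independent of u, R and ρ such that ‖u‖_{K²_β(W_R)} ≤ C ( ‖f‖_{K⁰_{β+2}(W_{R+ρ})} + ρ^{−1} ‖u‖_{K¹_{β+1}(W_{R+ρ})} + ρ^{−2} ‖u‖_{K⁰_{β+2}(W_{R+ρ})} ). -/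
open MeasureTheory Finset Real

noncomputable section

/-- The three coordinate directions of the wedge ambient space `ℂ × ℝ ≅ ℝ³`. -/
def dir3 : Fin 3 → ℂ × ℝ
  | 0 => (1, 0)
  | 1 => (Complex.I, 0)
  | 2 => (0, 1)

/-- Partial derivative in the `i`-th coordinate direction. -/
def pd3 (i : Fin 3) (u : ℂ × ℝ → ℝ) : ℂ × ℝ → ℝ := fun x => fderiv ℝ u x (dir3 i)

/-- Multi-index derivative `∂^α = ∂₁^{α₀} ∂₂^{α₁} ∂₃^{α₂}`. -/
def md3 (α : Fin 3 → ℕ) (u : ℂ × ℝ → ℝ) : ℂ × ℝ → ℝ :=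
  (pd3 0)^[α 0] ((pd3 1)^[α 1] ((pd3 2)^[α 2] u))

/-- The Laplacian on `ℝ³`. -/
def lap3 (u : ℂ × ℝ → ℝ) : ℂ × ℝ → ℝ :=
  fun x => pd3 0 (pd3 0 u) x + pd3 1 (pd3 1 u) x + pd3 2 (pd3 2 u) x

/-- The infinite plane sector `{ρ e^{iθ} : ρ > 0, ω₁ < θ < ω₂}` with vertex at the origin. -/
def SectorA (a b : ℝ) : Set ℂ :=
  {z | ∃ ρ θ : ℝ, 0 < ρ ∧ a < θ ∧ θ < b ∧ z = (ρ : ℂ) * Complex.exp ((θ : ℂ) * Complex.I)}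

/-- The open ray from the origin with polar angle `θ`. -/
def Ray (θ : ℝ) : Set ℂ :=
  {z | ∃ ρ : ℝ, 0 < ρ ∧ z = (ρ : ℂ) * Complex.exp ((θ : ℂ) * Complex.I)}

/-- The truncated wedge `W_ε = (K ∩ B(0,1+ε)) × (−1−ε, 1+ε)` inside the wedge
`D = K × ℝ` over the sector `K` of angles `(a,b)`; `W = W_0`. -/
def Wdom (a b ε : ℝ) : Set (ℂ × ℝ) :=
  (SectorA a b ∩ Metric.ball 0 (1 + ε)) ×ˢ Set.Ioo (-(1 + ε)) (1 + ε)

/-- The two faces `(∂K∖{0}) × ℝ` of the wedge. -/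
def Faces (a b : ℝ) : Set (ℂ × ℝ) := (Ray a ∪ Ray b) ×ˢ (Set.univ : Set ℝ)

/-- The edge `e = {x₁ = x₂ = 0}` of the wedge. -/
def EdgeSet : Set (ℂ × ℝ) := {p | p.1 = 0}

/-- Squared weighted seminorm `∑_{|α|=k} ‖r^{β+|α|} ∂^α u‖²_{L²(V)}`, `r(x) = |x_⊥|`. -/
def wKsemiSq (β : ℝ) (k : ℕ) (V : Set (ℂ × ℝ)) (u : ℂ × ℝ → ℝ) : ℝ :=
  ∑ α ∈ Finset.Nat.antidiagonalTuple 3 k, ∫ x in V, (‖x.1‖ ^ (β + (k : ℝ)) * md3 α u x) ^ 2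

/-- The weighted seminorm. -/
def wKsemi (β : ℝ) (k : ℕ) (V : Set (ℂ × ℝ)) (u : ℂ × ℝ → ℝ) : ℝ :=
  Real.sqrt (wKsemiSq β k V u)

/-- The norm `‖u‖_{K^m_β(V)}`. -/
def wKnorm (β : ℝ) (m : ℕ) (V : Set (ℂ × ℝ)) (u : ℂ × ℝ → ℝ) : ℝ :=
  Real.sqrt (∑ k ∈ Finset.range (m + 1), wKsemiSq β k V u)

/-- Membership `u ∈ K^m_β(V)`. -/
def wMemK (β : ℝ) (m : ℕ) (V : Set (ℂ × ℝ)) (u : ℂ × ℝ → ℝ) : Prop :=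
  ∀ k ≤ m, ∀ α ∈ Finset.Nat.antidiagonalTuple 3 k,
    IntegrableOn (fun x => (‖x.1‖ ^ (β + (k : ℝ)) * md3 α u x) ^ 2) V

/-- Homogeneous Dirichlet condition on the two faces of the truncated wedge `W_ε`. -/
def wDirBC (a b ε : ℝ) (u : ℂ × ℝ → ℝ) : Prop :=
  ∀ x ∈ Faces a b ∩ closure (Wdom a b ε), u x = 0

/-- **Edge a priori estimate (Assumption on the transversal operator, homogeneous norms):**
every `u ∈ K²_β(W)` solving `Δu = f` in `W_ε` with `u = 0` on the two faces and
`f ∈ K⁰_{β+2}(W_ε)` satisfies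
`‖u‖_{K²_β(W)} ≤ C₀(‖f‖_{K⁰_{β+2}(W_ε)} + ‖u‖_{K¹_{β+1}(W_ε)})`. -/
def EdgeAPrioriK (a b β ε : ℝ) : Prop :=
  ∃ C₀ : ℝ, 0 < C₀ ∧ ∀ u f : ℂ × ℝ → ℝ,
    ContDiffOn ℝ 2 u (closure (Wdom a b ε) \ EdgeSet) →
    wMemK β 2 (Wdom a b 0) u →
    wMemK (β + 1) 1 (Wdom a b ε) u →
    (∀ x ∈ Wdom a b ε, lap3 u x = f x) →
    wDirBC a b ε u →
    wMemK (β + 2) 0 (Wdom a b ε) f →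
    wKnorm β 2 (Wdom a b 0) u ≤
      C₀ * (wKnorm (β + 2) 0 (Wdom a b ε) f + wKnorm (β + 1) 1 (Wdom a b ε) u)

open scoped Pointwise

theorem isAddHaarMeasure_volume_prod : (volume : Measure (ℂ × ℝ)).IsAddHaarMeasure :=
  inferInstanceAs ((volume : Measure ℂ).prod (volume : Measure ℝ)).IsAddHaarMeasure

theorem SectorA_eq_image_exp (a b : ℝ) :
    SectorA a b = Complex.exp '' (Complex.im ⁻¹' Set.Ioo a b) := by
  ext z
  constructor
  · rintro ⟨r, θ, hr, ha, hb, rfl⟩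
    refine ⟨(Real.log r : ℂ) + θ * Complex.I, ?_, ?_⟩
    · simp [ha, hb]
    · rw [Complex.exp_add, ← Complex.ofReal_exp, Real.exp_log hr]
  · rintro ⟨w, ⟨ha, hb⟩, rfl⟩
    refine ⟨Real.exp w.re, w.im, Real.exp_pos _, ha, hb, ?_⟩
    rw [Complex.ofReal_exp, ← Complex.exp_add, Complex.re_add_im]

theorem isOpen_SectorA (a b : ℝ) : IsOpen (SectorA a b) := by
  rw [SectorA_eq_image_exp]
  exact Complex.isOpenMap_exp _ (isOpen_Ioo.preimage Complex.continuous_im)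

theorem isOpen_Wdom (a b ε : ℝ) : IsOpen (Wdom a b ε) :=
  ((isOpen_SectorA a b).inter Metric.isOpen_ball).prod isOpen_Ioo

theorem fst_ne_zero_of_mem_Wdom {a b ε : ℝ} {x : ℂ × ℝ} (hx : x ∈ Wdom a b ε) : x.1 ≠ 0 := by
  obtain ⟨⟨⟨r, θ, hr, -, -, h⟩, -⟩, -⟩ := hx
  rw [h]
  exact mul_ne_zero (by exact_mod_cast hr.ne') (Complex.exp_ne_zero _)

theorem smul_mem_SectorA {a b s : ℝ} (hs : 0 < s) {z : ℂ} (hz : z ∈ SectorA a b) :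
    s • z ∈ SectorA a b := by
  obtain ⟨r, θ, hr, ha, hb, rfl⟩ := hz
  exact ⟨s * r, θ, mul_pos hs hr, ha, hb, by rw [Complex.real_smul]; push_cast; ring⟩

theorem smul_mem_SectorA_iff {a b s : ℝ} (hs : 0 < s) {z : ℂ} :
    s • z ∈ SectorA a b ↔ z ∈ SectorA a b := by
  refine ⟨fun h => ?_, smul_mem_SectorA hs⟩
  simpa [smul_smul, hs.ne'] using smul_mem_SectorA (inv_pos.2 hs) h

theorem smul_mem_Ray {θ s : ℝ} (hs : 0 < s) {z : ℂ} (hz : z ∈ Ray θ) : s • z ∈ Ray θ := by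
  obtain ⟨r, hr, rfl⟩ := hz
  exact ⟨s * r, mul_pos hs hr, by rw [Complex.real_smul]; push_cast; ring⟩

theorem smul_mem_Faces {a b s : ℝ} (hs : 0 < s) {x : ℂ × ℝ} (hx : x ∈ Faces a b) :
    s • x ∈ Faces a b :=
  ⟨hx.1.imp (smul_mem_Ray hs) (smul_mem_Ray hs), trivial⟩

/-- The open cylinder cutting `W_ε` out of the wedge. -/
def Cyl (ε : ℝ) : Set (ℂ × ℝ) := Metric.ball 0 (1 + ε) ×ˢ Set.Ioo (-(1 + ε)) (1 + ε)

theorem mem_Cyl {ε : ℝ} {x : ℂ × ℝ} : x ∈ Cyl ε ↔ ‖x.1‖ < 1 + ε ∧ |x.2| < 1 + ε := by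
  simp [Cyl, Set.mem_prod, abs_lt]

theorem isOpen_Cyl (ε : ℝ) : IsOpen (Cyl ε) := Metric.isOpen_ball.prod isOpen_Ioo

theorem mem_Wdom {a b ε : ℝ} {x : ℂ × ℝ} :
    x ∈ Wdom a b ε ↔ x.1 ∈ SectorA a b ∧ x ∈ Cyl ε := by
  simp [Wdom, Cyl, Set.mem_prod, and_assoc]

theorem Cyl_mono {δ ε : ℝ} (h : δ ≤ ε) : Cyl δ ⊆ Cyl ε := fun x hx => by
  rw [mem_Cyl] at *
  exact ⟨by linarith, by linarith⟩

theorem Wdom_mono {a b δ ε : ℝ} (h : δ ≤ ε) : Wdom a b δ ⊆ Wdom a b ε := fun x hx => by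
  rw [mem_Wdom] at *
  exact ⟨hx.1, Cyl_mono h hx.2⟩

theorem closure_Wdom_inter_Cyl_subset (a b δ ε : ℝ) :
    closure (Wdom a b ε) ∩ Cyl δ ⊆ closure (Wdom a b δ) := by
  refine ((isOpen_Cyl δ).closure_inter).trans (closure_mono fun x hx => ?_)
  exact mem_Wdom.2 ⟨(mem_Wdom.1 hx.1).1, hx.2⟩

theorem smul_mem_Wdom_iff {a b ε s : ℝ} (hs : 0 < s) {x : ℂ × ℝ} :
    s • x ∈ Wdom a b (s * (1 + ε) - 1) ↔ x ∈ Wdom a b ε := by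
  rw [mem_Wdom, mem_Wdom, mem_Cyl, mem_Cyl, Prod.smul_fst, Prod.smul_snd, smul_mem_SectorA_iff hs,
    norm_smul, smul_eq_mul, abs_mul, Real.norm_eq_abs, abs_of_pos hs, add_sub_cancel,
    mul_lt_mul_iff_right₀ hs, mul_lt_mul_iff_right₀ hs]

theorem smul_Wdom {a b ε s : ℝ} (hs : 0 < s) :
    s • Wdom a b ε = Wdom a b (s * (1 + ε) - 1) := by
  ext x
  rw [Set.mem_smul_set_iff_inv_smul_mem₀ hs.ne', ← smul_mem_Wdom_iff hs, smul_inv_smul₀ hs.ne']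

theorem smul_mem_closure_Wdom {a b ε s : ℝ} (hs : 0 < s) {x : ℂ × ℝ}
    (hx : x ∈ closure (Wdom a b ε)) : s • x ∈ closure (Wdom a b (s * (1 + ε) - 1)) :=
  map_mem_closure (continuous_const_smul s) hx fun _ hy => (smul_mem_Wdom_iff hs).2 hy

theorem pd3_comp_smul (i : Fin 3) (c s : ℝ) (g : ℂ × ℝ → ℝ) :
    pd3 i (fun x => c * g (s • x)) = fun x => c * s * pd3 i g (s • x) := by
  funext x
  have h : fderiv ℝ (fun x => c * g (s • x)) x = c • s • fderiv ℝ g (s • x) := by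
    rw [← fderiv_comp_smul s]
    exact congrFun (fderiv_const_smul_field (𝕜 := ℝ) (f := fun x => g (s • x)) c) x
  simp [pd3, h, mul_assoc]

theorem iterate_pd3_comp_smul (i : Fin 3) (c s : ℝ) (n : ℕ) (g : ℂ × ℝ → ℝ) :
    (pd3 i)^[n] (fun x => c * g (s • x)) = fun x => c * s ^ n * (pd3 i)^[n] g (s • x) := by
  induction n with
  | zero => simp
  | succ n ih =>
    rw [Function.iterate_succ_apply', ih, pd3_comp_smul, Function.iterate_succ_apply']
    simp only [pow_succ, mul_assoc]

theorem md3_comp_smul (α : Fin 3 → ℕ) (s : ℝ) (g : ℂ × ℝ → ℝ) (x : ℂ × ℝ) :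
    md3 α (fun x => g (s • x)) x = s ^ (α 0 + α 1 + α 2) * md3 α g (s • x) := by
  have h : (fun x => g (s • x)) = fun x => 1 * g (s • x) := by simp
  rw [md3, h, iterate_pd3_comp_smul, iterate_pd3_comp_smul, iterate_pd3_comp_smul, md3]
  ring

theorem lap3_comp_smul (s : ℝ) (g : ℂ × ℝ → ℝ) :
    lap3 (fun x => g (s • x)) = fun x => s ^ 2 * lap3 g (s • x) := by
  have h : (fun x => g (s • x)) = fun x => 1 * g (s • x) := by simp
  funext x
  simp only [lap3, h, pd3_comp_smul]
  ring

theorem pd3_eqOn {U : Set (ℂ × ℝ)} (hU : IsOpen U) (i : Fin 3) {f g : ℂ × ℝ → ℝ}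
    (h : Set.EqOn f g U) : Set.EqOn (pd3 i f) (pd3 i g) U := fun x hx => by
  rw [pd3, pd3, (h.eventuallyEq_of_mem (hU.mem_nhds hx)).fderiv_eq]

theorem iterate_pd3_eqOn {U : Set (ℂ × ℝ)} (hU : IsOpen U) (i : Fin 3) (n : ℕ) {f g : ℂ × ℝ → ℝ}
    (h : Set.EqOn f g U) : Set.EqOn ((pd3 i)^[n] f) ((pd3 i)^[n] g) U := by
  induction n with
  | zero => exact h
  | succ n ih =>
    rw [Function.iterate_succ_apply', Function.iterate_succ_apply']
    exact pd3_eqOn hU i ih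

theorem md3_eqOn {U : Set (ℂ × ℝ)} (hU : IsOpen U) (α : Fin 3 → ℕ) {f g : ℂ × ℝ → ℝ}
    (h : Set.EqOn f g U) : Set.EqOn (md3 α f) (md3 α g) U :=
  iterate_pd3_eqOn hU _ _ (iterate_pd3_eqOn hU _ _ (iterate_pd3_eqOn hU _ _ h))

theorem lap3_eqOn {U : Set (ℂ × ℝ)} (hU : IsOpen U) {f g : ℂ × ℝ → ℝ}
    (h : Set.EqOn f g U) : Set.EqOn (lap3 f) (lap3 g) U := fun x hx => by
  have h2 := fun i => pd3_eqOn hU i (pd3_eqOn hU i h) hx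
  simp only [lap3, h2]

theorem setIntegral_weighted_comp_smul {s : ℝ} (hs : 0 < s) (γ : ℝ) (n : ℕ) (V : Set (ℂ × ℝ))
    (F : ℂ × ℝ → ℝ) :
    ∫ x in V, (‖x.1‖ ^ (γ + n) * (s ^ n * F (s • x))) ^ 2 =
      (s ^ γ)⁻¹ ^ 2 * (s ^ 3)⁻¹ * ∫ x in s • V, (‖x.1‖ ^ (γ + n) * F x) ^ 2 := by
  have := isAddHaarMeasure_volume_prod
  have h := Measure.setIntegral_comp_smul_of_pos volume
    (fun x : ℂ × ℝ => (‖x.1‖ ^ (γ + n) * F x) ^ 2) V hs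
  have hd : Module.finrank ℝ (ℂ × ℝ) = 3 := by simp
  rw [hd, smul_eq_mul] at h
  rw [mul_assoc, ← h, ← integral_const_mul]
  congr 1 with x
  rw [Prod.smul_fst, norm_smul, Real.norm_of_nonneg hs.le, Real.mul_rpow hs.le (norm_nonneg _),
    Real.rpow_add_natCast hs.ne']
  have := (Real.rpow_pos_of_pos hs γ).ne'
  field_simp

theorem wKsemiSq_comp_smul {s : ℝ} (hs : 0 < s) (β : ℝ) (k : ℕ) (V : Set (ℂ × ℝ))
    (g : ℂ × ℝ → ℝ) :
    wKsemiSq β k V (fun x => g (s • x)) =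
      (s ^ β)⁻¹ ^ 2 * (s ^ 3)⁻¹ * wKsemiSq β k (s • V) g := by
  rw [wKsemiSq, wKsemiSq, Finset.mul_sum]
  refine Finset.sum_congr rfl fun α hα => ?_
  rw [Finset.Nat.mem_antidiagonalTuple, Fin.sum_univ_three] at hα
  simp only [md3_comp_smul, hα]
  exact setIntegral_weighted_comp_smul hs β k V _

theorem wKnorm_comp_smul {s : ℝ} (hs : 0 < s) (β : ℝ) (m : ℕ) (V : Set (ℂ × ℝ))
    (g : ℂ × ℝ → ℝ) :
    wKnorm β m V (fun x => g (s • x)) =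
      (s ^ β)⁻¹ * √(s ^ 3)⁻¹ * wKnorm β m (s • V) g := by
  simp only [wKnorm, wKsemiSq_comp_smul hs, ← Finset.mul_sum]
  rw [Real.sqrt_mul (by positivity), Real.sqrt_mul (by positivity), Real.sqrt_sq (by positivity)]

theorem integrableOn_comp_smul_of_pos {s : ℝ} (hs : 0 < s) {V : Set (ℂ × ℝ)} (hV : MeasurableSet V)
    {F : ℂ × ℝ → ℝ} (hF : IntegrableOn F (s • V)) : IntegrableOn (fun x => F (s • x)) V := by
  have := isAddHaarMeasure_volume_prod
  have hV' : MeasurableSet (s • V) := hV.const_smul₀ s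
  rw [← integrable_indicator_iff hV'] at hF
  rw [← integrable_indicator_iff hV]
  refine (hF.comp_smul hs.ne').congr (Filter.Eventually.of_forall fun x => ?_)
  by_cases hx : x ∈ V <;> simp [hx, Set.smul_mem_smul_set_iff₀ hs.ne']

theorem wMemK.comp_smul {s : ℝ} (hs : 0 < s) {β : ℝ} {m : ℕ} {V : Set (ℂ × ℝ)}
    (hV : MeasurableSet V) {g : ℂ × ℝ → ℝ} (hg : wMemK β m (s • V) g) :
    wMemK β m V (fun x => g (s • x)) := by
  intro k hk α hα
  have h := (integrableOn_comp_smul_of_pos hs hV (hg k hk α hα)).const_mul ((s ^ β)⁻¹ ^ 2)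
  rw [Finset.Nat.mem_antidiagonalTuple, Fin.sum_univ_three] at hα
  refine h.congr (Filter.Eventually.of_forall fun x => ?_)
  simp only [md3_comp_smul, hα]
  rw [Prod.smul_fst, norm_smul, Real.norm_of_nonneg hs.le, Real.mul_rpow hs.le (norm_nonneg _),
    Real.rpow_add_natCast hs.ne']
  have := (Real.rpow_pos_of_pos hs β).ne'
  field_simp

theorem wKsemiSq_nonneg (β : ℝ) (k : ℕ) (V : Set (ℂ × ℝ)) (u : ℂ × ℝ → ℝ) :
    0 ≤ wKsemiSq β k V u :=
  Finset.sum_nonneg fun _ _ => integral_nonneg fun _ => sq_nonneg _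

theorem wKnorm_nonneg (β : ℝ) (m : ℕ) (V : Set (ℂ × ℝ)) (u : ℂ × ℝ → ℝ) : 0 ≤ wKnorm β m V u :=
  Real.sqrt_nonneg _

theorem wKsemiSq_zero (β : ℝ) (V : Set (ℂ × ℝ)) (u : ℂ × ℝ → ℝ) :
    wKsemiSq β 0 V u = ∫ x in V, (‖x.1‖ ^ β * u x) ^ 2 := by
  simp [wKsemiSq, Finset.Nat.antidiagonalTuple_zero_right, md3]

theorem antidiagonalTuple_three_one :
    Finset.Nat.antidiagonalTuple 3 1 = {![1, 0, 0], ![0, 1, 0], ![0, 0, 1]} := by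
  decide

theorem wKsemiSq_one (β : ℝ) (V : Set (ℂ × ℝ)) (u : ℂ × ℝ → ℝ) :
    wKsemiSq β 1 V u = ∑ i, ∫ x in V, (‖x.1‖ ^ (β + 1) * pd3 i u x) ^ 2 := by
  rw [wKsemiSq, antidiagonalTuple_three_one, Finset.sum_insert (by decide),
    Finset.sum_insert (by decide), Finset.sum_singleton, Fin.sum_univ_three]
  simp [md3, add_assoc]

theorem wKnorm_zero_sq (β : ℝ) (V : Set (ℂ × ℝ)) (u : ℂ × ℝ → ℝ) :
    wKnorm β 0 V u ^ 2 = ∫ x in V, (‖x.1‖ ^ β * u x) ^ 2 := by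
  rw [wKnorm, Real.sq_sqrt (Finset.sum_nonneg fun _ _ => wKsemiSq_nonneg _ _ _ _),
    Finset.sum_range_one, wKsemiSq_zero]

theorem wKnorm_one_sq (β : ℝ) (V : Set (ℂ × ℝ)) (u : ℂ × ℝ → ℝ) :
    wKnorm β 1 V u ^ 2 = (∫ x in V, (‖x.1‖ ^ β * u x) ^ 2) +
      ∑ i, ∫ x in V, (‖x.1‖ ^ (β + 1) * pd3 i u x) ^ 2 := by
  rw [wKnorm, Real.sq_sqrt (Finset.sum_nonneg fun _ _ => wKsemiSq_nonneg _ _ _ _),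
    Finset.sum_range_succ, Finset.sum_range_one, wKsemiSq_zero, wKsemiSq_one]

theorem wMemK_zero_iff {β : ℝ} {V : Set (ℂ × ℝ)} {u : ℂ × ℝ → ℝ} :
    wMemK β 0 V u ↔ IntegrableOn (fun x => (‖x.1‖ ^ β * u x) ^ 2) V := by
  simp [wMemK, Finset.Nat.antidiagonalTuple_zero_right, md3]

theorem wMemK_one_iff {β : ℝ} {V : Set (ℂ × ℝ)} {u : ℂ × ℝ → ℝ} :
    wMemK β 1 V u ↔ IntegrableOn (fun x => (‖x.1‖ ^ β * u x) ^ 2) V ∧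
      ∀ i, IntegrableOn (fun x => (‖x.1‖ ^ (β + 1) * pd3 i u x) ^ 2) V := by
  have h1 (k : ℕ) : k ≤ 1 ↔ k = 0 ∨ k = 1 := by lia
  rw [wMemK, Fin.forall_fin_succ, Fin.forall_fin_two]
  simp only [h1, antidiagonalTuple_three_one, Finset.mem_insert, Finset.mem_singleton, forall_eq_or_imp,
    forall_eq]
  simp [Finset.Nat.antidiagonalTuple_zero_right, md3]

theorem wMemK.mono_set {β : ℝ} {m : ℕ} {V V' : Set (ℂ × ℝ)} {u : ℂ × ℝ → ℝ}
    (h : wMemK β m V u) (hV : V' ⊆ V) : wMemK β m V' u :=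
  fun k hk α hα => (h k hk α hα).mono_set hV

theorem wMemK.congr_of_isOpen {β : ℝ} {m : ℕ} {V : Set (ℂ × ℝ)} {u v : ℂ × ℝ → ℝ}
    (h : wMemK β m V u) (hV : IsOpen V) (huv : Set.EqOn u v V) : wMemK β m V v :=
  fun k hk α hα => (h k hk α hα).congr_fun
    (fun x hx => by simp only [md3_eqOn hV α huv hx]) hV.measurableSet

theorem wKnorm_congr_of_isOpen (β : ℝ) (m : ℕ) {V : Set (ℂ × ℝ)} {u v : ℂ × ℝ → ℝ}
    (hV : IsOpen V) (huv : Set.EqOn u v V) : wKnorm β m V u = wKnorm β m V v := by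
  simp only [wKnorm, wKsemiSq]
  congr 1
  refine Finset.sum_congr rfl fun k _ => Finset.sum_congr rfl fun α _ => ?_
  exact setIntegral_congr_fun hV.measurableSet
    fun x hx => by simp only [md3_eqOn hV α huv hx]

theorem wMemK.const_mul {β c : ℝ} {V : Set (ℂ × ℝ)} {u : ℂ × ℝ → ℝ}
    (h : wMemK β 0 V u) : wMemK β 0 V (fun x => c * u x) := by
  rw [wMemK_zero_iff] at *
  refine (Integrable.const_mul h (c ^ 2)).congr (Filter.Eventually.of_forall fun x => ?_)
  ring

theorem wKnorm_zero_const_mul {c : ℝ} (hc : 0 ≤ c) (β : ℝ) (V : Set (ℂ × ℝ)) (u : ℂ × ℝ → ℝ) :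
    wKnorm β 0 V (fun x => c * u x) = c * wKnorm β 0 V u := by
  rw [← sq_eq_sq₀ (wKnorm_nonneg _ _ _ _) (mul_nonneg hc (wKnorm_nonneg _ _ _ _)), mul_pow,
    wKnorm_zero_sq, wKnorm_zero_sq, ← integral_const_mul]
  congr 1 with x
  ring

/-- Raising the weight exponent by `1` preserves integrability on the bounded wedge. -/
theorem integrableOn_weight_add_one {a b ε γ : ℝ} {v : ℂ × ℝ → ℝ}
    (h : IntegrableOn (fun x => (‖x.1‖ ^ γ * v x) ^ 2) (Wdom a b ε)) :
    IntegrableOn (fun x => (‖x.1‖ ^ (γ + 1) * v x) ^ 2) (Wdom a b ε) := by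
  have hm := (isOpen_Wdom a b ε).measurableSet
  have h2 : IntegrableOn (fun x => ‖x.1‖ ^ 2 * (‖x.1‖ ^ γ * v x) ^ 2) (Wdom a b ε) := by
    refine Integrable.bdd_mul (c := (1 + ε) ^ 2) h (by fun_prop) ?_
    refine (ae_restrict_iff' hm).2 (Filter.Eventually.of_forall fun x hx => ?_)
    have := (mem_Cyl.1 (mem_Wdom.1 hx).2).1
    rw [norm_pow, norm_norm]
    gcongr
  refine h2.congr_fun (fun x hx => ?_) hm
  have hx0 : 0 < ‖x.1‖ := norm_pos_iff.2 (fst_ne_zero_of_mem_Wdom hx)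
  simp only [Real.rpow_add_one hx0.ne']
  ring

theorem pd3_mul_eqOn {U : Set (ℂ × ℝ)} (hU : IsOpen U) (i : Fin 3) {f g : ℂ × ℝ → ℝ}
    (hf : ContDiffOn ℝ 1 f U) (hg : ContDiffOn ℝ 1 g U) :
    Set.EqOn (pd3 i (fun x => f x * g x)) (fun x => f x * pd3 i g x + g x * pd3 i f x) U := by
  intro x hx
  have hf' := (hf.contDiffAt (hU.mem_nhds hx)).differentiableAt one_ne_zero
  have hg' := (hg.contDiffAt (hU.mem_nhds hx)).differentiableAt one_ne_zero
  simp [pd3, fderiv_fun_mul hf' hg']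

theorem contDiffOn_pd3 {U : Set (ℂ × ℝ)} (hU : IsOpen U) (i : Fin 3) {f : ℂ × ℝ → ℝ}
    {n : WithTop ℕ∞} (hf : ContDiffOn ℝ (n + 1) f U) : ContDiffOn ℝ n (pd3 i f) U :=
  (hf.fderiv_of_isOpen hU le_rfl).clm_apply contDiffOn_const

theorem pd3_pd3_mul_eqOn {U : Set (ℂ × ℝ)} (hU : IsOpen U) (i : Fin 3) {f g : ℂ × ℝ → ℝ}
    (hf : ContDiffOn ℝ 2 f U) (hg : ContDiffOn ℝ 2 g U) :
    Set.EqOn (pd3 i (pd3 i (fun x => f x * g x)))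
      (fun x => f x * pd3 i (pd3 i g) x + 2 * (pd3 i f x * pd3 i g x) +
        g x * pd3 i (pd3 i f) x) U := by
  intro x hx
  have hf1 : ContDiffOn ℝ 1 f U := hf.of_le one_le_two
  have hg1 : ContDiffOn ℝ 1 g U := hg.of_le one_le_two
  have hfi : ContDiffOn ℝ 1 (pd3 i f) U := contDiffOn_pd3 hU i (by simpa [one_add_one_eq_two])
  have hgi : ContDiffOn ℝ 1 (pd3 i g) U := contDiffOn_pd3 hU i (by simpa [one_add_one_eq_two])
  rw [pd3_eqOn hU i (pd3_mul_eqOn hU i hf1 hg1) hx]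
  have h1 := ((hf1.mul hgi).contDiffAt (hU.mem_nhds hx)).differentiableAt one_ne_zero
  have h2 := ((hg1.mul hfi).contDiffAt (hU.mem_nhds hx)).differentiableAt one_ne_zero
  have h3 : pd3 i (fun x => f x * pd3 i g x + g x * pd3 i f x) x =
      pd3 i (fun x => f x * pd3 i g x) x + pd3 i (fun x => g x * pd3 i f x) x := by
    simp only [pd3] at *
    rw [fderiv_fun_add h1 h2]
    rfl
  rw [h3, pd3_mul_eqOn hU i hf1 hgi hx, pd3_mul_eqOn hU i hg1 hfi hx]
  ring

theorem lap3_mul_eqOn {U : Set (ℂ × ℝ)} (hU : IsOpen U) {f g : ℂ × ℝ → ℝ}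
    (hf : ContDiffOn ℝ 2 f U) (hg : ContDiffOn ℝ 2 g U) :
    Set.EqOn (lap3 (fun x => f x * g x))
      (fun x => f x * lap3 g x + 2 * ∑ i, pd3 i f x * pd3 i g x + g x * lap3 f x) U := by
  intro x hx
  simp only [lap3, pd3_pd3_mul_eqOn hU _ hf hg hx, Fin.sum_univ_three]
  ring

theorem continuousOn_lap3 {U : Set (ℂ × ℝ)} (hU : IsOpen U) {f : ℂ × ℝ → ℝ}
    (hf : ContDiffOn ℝ 2 f U) : ContinuousOn (lap3 f) U := by
  have h (i : Fin 3) : ContinuousOn (pd3 i (pd3 i f)) U :=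
    (contDiffOn_pd3 (n := 0) hU i
      (contDiffOn_pd3 hU i (by simpa [one_add_one_eq_two]))).continuousOn
  exact ((h 0).add (h 1)).add (h 2)

theorem pd3_comp {η : ℝ → ℝ} {q : ℂ × ℝ → ℝ} (hη : Differentiable ℝ η) (hq : Differentiable ℝ q)
    (i : Fin 3) : pd3 i (fun x => η (q x)) = fun x => deriv η (q x) * pd3 i q x := by
  funext x
  have h := (hη (q x)).hasDerivAt.comp_hasFDerivAt x (hq x).hasFDerivAt
  simp only [pd3]
  erw [h.fderiv]
  rfl

/-- A `C²` cutoff on the line with bounded first and second derivatives. -/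
theorem exists_real_cutoff : ∃ (η : ℝ → ℝ) (M : ℝ), ContDiff ℝ 2 η ∧ 0 < M ∧
    (∀ t ≤ 0, η t = 1) ∧ (∀ t, 1 ≤ t → η t = 0) ∧ (∀ t, |η t| ≤ 1) ∧
    (∀ t, |deriv η t| ≤ M) ∧ (∀ t, |deriv (deriv η) t| ≤ M) := by
  set η : ℝ → ℝ := fun t => Real.smoothTransition (1 - t) with hη_def
  have hη : ContDiff ℝ 2 η :=
    (Real.smoothTransition.contDiff (n := 2)).comp (contDiff_const.sub contDiff_id)
  have h0 : ∀ t ≤ 0, η t = 1 := fun t ht => Real.smoothTransition.one_of_one_le (by linarith)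
  have h1 : ∀ t, 1 ≤ t → η t = 0 := fun t ht => Real.smoothTransition.zero_of_nonpos (by linarith)
  have hd1 : ContDiff ℝ 1 (deriv η) :=
    (contDiff_succ_iff_deriv.1 (by simpa [one_add_one_eq_two] using hη)).2.2
  have hd2 : Continuous (deriv (deriv η)) := hd1.continuous_deriv le_rfl
  have hsupp : ∀ t ∉ Set.Icc (0 : ℝ) 1, deriv η t = 0 := by
    intro t ht
    rcases lt_or_ge t 0 with h | h
    · have : η =ᶠ[nhds t] fun _ => 1 := by
        filter_upwards [Iio_mem_nhds h] with y hy using h0 y (le_of_lt hy)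
      rw [this.deriv_eq, deriv_const]
    · have ht1 : 1 < t := by
        by_contra! hc
        exact ht ⟨h, hc⟩
      have : η =ᶠ[nhds t] fun _ => 0 := by
        filter_upwards [Ioi_mem_nhds ht1] with y hy using h1 y (le_of_lt hy)
      rw [this.deriv_eq, deriv_const]
  have hc1 : HasCompactSupport (deriv η) := HasCompactSupport.intro isCompact_Icc hsupp
  obtain ⟨M1, hM1⟩ := hd1.continuous.bounded_above_of_compact_support hc1
  obtain ⟨M2, hM2⟩ := hd2.bounded_above_of_compact_support hc1.deriv
  refine ⟨η, max 1 (max M1 M2), hη, by positivity, h0, h1, fun t => ?_, fun t => ?_, fun t => ?_⟩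
  · rw [abs_of_nonneg (Real.smoothTransition.nonneg _)]
    exact Real.smoothTransition.le_one _
  · exact (hM1 t).trans ((le_max_left _ _).trans (le_max_right _ _))
  · exact (hM2 t).trans ((le_max_right _ _).trans (le_max_right _ _))
/-- The three Cartesian coordinates on `ℂ × ℝ`. -/
def coord3 : Fin 3 → (ℂ × ℝ →L[ℝ] ℝ)
  | 0 => Complex.reCLM.comp (ContinuousLinearMap.fst ℝ ℂ ℝ)
  | 1 => Complex.imCLM.comp (ContinuousLinearMap.fst ℝ ℂ ℝ)
  | 2 => ContinuousLinearMap.snd ℝ ℂ ℝ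

theorem coord3_dir3 (i j : Fin 3) : coord3 j (dir3 i) = if i = j then 1 else 0 := by
  fin_cases i <;> fin_cases j <;> simp [coord3, dir3]

theorem abs_coord3_le {ε : ℝ} {x : ℂ × ℝ} (hx : x ∈ Cyl ε) (i : Fin 3) : |coord3 i x| ≤ 1 + ε := by
  obtain ⟨h1, h2⟩ := mem_Cyl.1 hx
  fin_cases i
  · exact (Complex.abs_re_le_norm x.1).trans h1.le
  · exact (Complex.abs_im_le_norm x.1).trans h1.le
  · exact h2.le

theorem pd3_const_mul_coord3 (i : Fin 3) (k : ℝ) :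
    pd3 i (fun x => k * coord3 i x) = fun _ => k := by
  funext x
  have h : HasFDerivAt (fun x => k * coord3 i x) (k • coord3 i) x :=
    (coord3 i).hasFDerivAt.const_mul k
  simp [pd3, h.fderiv, coord3_dir3]

theorem pd3_quadratic (w : Fin 3 → ℝ) (c k : ℝ) (i : Fin 3) :
    pd3 i (fun x => k * (∑ j, w j * coord3 j x ^ 2 - c)) =
      fun x => 2 * k * w i * coord3 i x := by
  funext x
  have h : HasFDerivAt (fun x => k * (∑ j, w j * coord3 j x ^ 2 - c))
      (k • ∑ j, w j • (2 • coord3 j x ^ (2 - 1)) • coord3 j) x := by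
    refine HasFDerivAt.const_mul (HasFDerivAt.sub_const _ (HasFDerivAt.fun_sum fun j _ => ?_)) k
    exact HasFDerivAt.const_mul ((coord3 j).hasFDerivAt.pow 2) (w j)
  rw [pd3, h.fderiv]
  simp [coord3_dir3]
  ring

/-- A function of a quadratic form, used as one factor of the cutoff. -/
theorem quadratic_cutoff_bounds {η : ℝ → ℝ} {M : ℝ} (hη : ContDiff ℝ 2 η)
    (hη0 : ∀ t, |η t| ≤ 1) (hη1 : ∀ t, |deriv η t| ≤ M)
    (hη2 : ∀ t, |deriv (deriv η) t| ≤ M) {w : Fin 3 → ℝ} (hw : ∀ i, |w i| ≤ 1) (c : ℝ)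
    {ε k : ℝ} (hk : 0 ≤ k) {x : ℂ × ℝ} (hx : x ∈ Cyl ε) (i : Fin 3) :
    let φ : ℂ × ℝ → ℝ := fun x => η (k * (∑ j, w j * coord3 j x ^ 2 - c))
    ContDiff ℝ 2 φ ∧ |φ x| ≤ 1 ∧ |pd3 i φ x| ≤ 2 * M * (1 + ε) * k ∧
      |pd3 i (pd3 i φ) x| ≤ 4 * M * (1 + ε) ^ 2 * k ^ 2 + 2 * M * k := by
  intro φ
  have hM : 0 ≤ M := (abs_nonneg _).trans (hη1 0)
  have hε : 0 ≤ 1 + ε := (norm_nonneg _).trans (mem_Cyl.1 hx).1.le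
  set q : ℂ × ℝ → ℝ := fun x => k * (∑ j, w j * coord3 j x ^ 2 - c) with hq_def
  have hq : ContDiff ℝ 2 q := by fun_prop
  have hqd : Differentiable ℝ q := hq.differentiable two_ne_zero
  have hηd : ContDiff ℝ 1 (deriv η) :=
    (contDiff_succ_iff_deriv.1 (by simpa [one_add_one_eq_two] using hη)).2.2
  have h1 : pd3 i φ = fun x => deriv η (q x) * (2 * k * w i * coord3 i x) := by
    rw [pd3_comp (hη.differentiable two_ne_zero) hqd, pd3_quadratic]
  have h2 : pd3 i (pd3 i φ) x = deriv (deriv η) (q x) * (2 * k * w i * coord3 i x) ^ 2 +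
      deriv η (q x) * (2 * k * w i) := by
    have hf : ContDiff ℝ 1 (fun x => deriv η (q x)) := hηd.comp (hq.of_le one_le_two)
    have hg : ContDiff ℝ 1 (fun x => 2 * k * w i * coord3 i x) := by fun_prop
    rw [h1, pd3_mul_eqOn isOpen_univ i hf.contDiffOn hg.contDiffOn (Set.mem_univ x),
      pd3_const_mul_coord3,
      pd3_comp (hηd.differentiable one_ne_zero) hqd, pd3_quadratic]
    ring
  have hl : |2 * k * w i * coord3 i x| ≤ 2 * k * 1 * (1 + ε) := by
    rw [abs_mul, abs_mul, abs_of_nonneg (by positivity : 0 ≤ 2 * k)]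
    gcongr
    · exact hw i
    · exact abs_coord3_le hx i
  refine ⟨hη.comp hq, hη0 _, ?_, ?_⟩
  · rw [h1, abs_mul]
    calc _ ≤ M * (2 * k * 1 * (1 + ε)) := by gcongr; exact hη1 _
      _ = _ := by ring
  · rw [h2]
    refine (abs_add_le _ _).trans ?_
    rw [abs_mul, abs_mul, abs_pow, abs_mul (2 * k), abs_of_nonneg (by positivity : 0 ≤ 2 * k)]
    calc _ ≤ M * (2 * k * 1 * (1 + ε)) ^ 2 + M * (2 * k * 1) := by
          gcongr
          · exact hη2 _
          · exact hη1 _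
          · exact hw i
      _ = _ := by ring

theorem exists_cylinder_cutoff (ε : ℝ) :
    ∃ M : ℝ, 0 < M ∧ ∀ R ρ : ℝ, 0 ≤ R → 0 < ρ → R + ρ ≤ ε →
      ∃ χ : ℂ × ℝ → ℝ, ContDiff ℝ 2 χ ∧ (∀ x ∈ Cyl R, χ x = 1) ∧
        tsupport χ ⊆ Cyl (R + ρ) ∧ ∀ x ∈ Cyl (R + ρ), |χ x| ≤ 1 ∧
          (∀ i, |pd3 i χ x| ≤ M * ρ⁻¹) ∧ |lap3 χ x| ≤ M * ρ⁻¹ ^ 2 := by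
  obtain ⟨η, M, hη, hM, hη1, hη0, hb0, hb1, hb2⟩ := exists_real_cutoff
  set A := 2 * M * (1 + |ε|) with hA
  set B := 4 * M * (1 + |ε|) ^ 2 + 2 * M * |ε| with hB
  have hA0 : 0 < A := by positivity
  have hB0 : 0 < B := by positivity
  refine ⟨2 * A + 6 * A ^ 2 + 6 * B, by positivity, fun R ρ hR hρ hRρ => ?_⟩
  have hε : 0 < ε := by linarith
  rw [abs_of_pos hε] at hA hB
  set c := (1 + R) ^ 2
  let w1 : Fin 3 → ℝ := ![1, 1, 0]
  let w2 : Fin 3 → ℝ := ![0, 0, 1]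
  have hw1 : ∀ i, |w1 i| ≤ 1 := by intro i; fin_cases i <;> simp [w1]
  have hw2 : ∀ i, |w2 i| ≤ 1 := by intro i; fin_cases i <;> simp [w2]
  let q1 : ℂ × ℝ → ℝ := fun x => ρ⁻¹ * (∑ j, w1 j * coord3 j x ^ 2 - c)
  let q2 : ℂ × ℝ → ℝ := fun x => ρ⁻¹ * (∑ j, w2 j * coord3 j x ^ 2 - c)
  have hq1 : ∀ x, q1 x = ρ⁻¹ * (‖x.1‖ ^ 2 - c) := by
    intro x
    have : ∑ j, w1 j * coord3 j x ^ 2 = ‖x.1‖ ^ 2 := by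
      rw [Complex.sq_norm, Complex.normSq_apply]
      simp [Fin.sum_univ_three, w1, coord3, sq]
    simp only [q1, this]
  have hq2 : ∀ x, q2 x = ρ⁻¹ * (|x.2| ^ 2 - c) := by
    intro x
    simp [q2, Fin.sum_univ_three, w2, coord3]
  let φ : ℂ × ℝ → ℝ := fun x => η (q1 x)
  let ψ : ℂ × ℝ → ℝ := fun x => η (q2 x)
  have hmem : ∀ x, q1 x ≤ 1 → q2 x ≤ 1 → x ∈ Cyl (R + ρ) := by
    have key : ∀ y : ℝ, 0 ≤ y → ρ⁻¹ * (y ^ 2 - c) ≤ 1 → y < 1 + (R + ρ) := by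
      intro y hy h
      rw [inv_mul_le_iff₀ hρ] at h
      by_contra! hc
      have : (1 + (R + ρ)) ^ 2 ≤ y ^ 2 := by gcongr
      nlinarith [mul_nonneg hR hρ.le, sq_nonneg ρ]
    intro x h1 h2
    rw [hq1] at h1
    rw [hq2] at h2
    exact mem_Cyl.2 ⟨key _ (norm_nonneg _) h1, key _ (abs_nonneg _) h2⟩
  have hk : 0 ≤ ρ⁻¹ := by positivity
  have hone : 1 ≤ ε * ρ⁻¹ := by
    rw [← div_eq_mul_inv, one_le_div hρ]
    linarith
  have hφ : ContDiff ℝ 2 φ := hη.comp (by fun_prop)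
  have hψ : ContDiff ℝ 2 ψ := hη.comp (by fun_prop)
  have hB2 : 4 * M * (1 + ε) ^ 2 * ρ⁻¹ ^ 2 + 2 * M * ρ⁻¹ ≤ B * ρ⁻¹ ^ 2 := by
    rw [hB]
    nlinarith [mul_le_mul_of_nonneg_left hone (by positivity : 0 ≤ 2 * M * ρ⁻¹)]
  refine ⟨fun x => φ x * ψ x, hφ.mul hψ, fun x hx => ?_, ?_, fun x hx => ?_⟩
  · have key : ∀ y : ℝ, 0 ≤ y → y < 1 + R → ρ⁻¹ * (y ^ 2 - c) ≤ 0 := by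
      intro y hy h
      have : y ^ 2 ≤ c := pow_le_pow_left₀ hy h.le 2
      exact mul_nonpos_of_nonneg_of_nonpos hk (by linarith)
    obtain ⟨h1, h2⟩ := mem_Cyl.1 hx
    have e1 : φ x = 1 := hη1 _ (by rw [hq1]; exact key _ (norm_nonneg _) h1)
    have e2 : ψ x = 1 := hη1 _ (by rw [hq2]; exact key _ (abs_nonneg _) h2)
    simp [e1, e2]
  · have hcl : IsClosed {x | q1 x ≤ 1 ∧ q2 x ≤ 1} :=
      (isClosed_le (f := q1) (by fun_prop) continuous_const).inter
        (isClosed_le (f := q2) (by fun_prop) continuous_const)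
    refine (closure_minimal (fun x hx => ?_) hcl).trans fun x hx => hmem x hx.1 hx.2
    rw [Function.mem_support, mul_ne_zero_iff] at hx
    constructor
    · by_contra! hc
      exact hx.1 (hη0 _ hc.le)
    · by_contra! hc
      exact hx.2 (hη0 _ hc.le)
  · have hx' : x ∈ Cyl ε := Cyl_mono hRρ hx
    have b1 := fun i => quadratic_cutoff_bounds hη hb0 hb1 hb2 hw1 c hk hx' i
    have b2 := fun i => quadratic_cutoff_bounds hη hb0 hb1 hb2 hw2 c hk hx' i
    have hφ0 : |φ x| ≤ 1 := hb0 _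
    have hψ0 : |ψ x| ≤ 1 := hb0 _
    have hφ1 : ∀ i, |pd3 i φ x| ≤ A * ρ⁻¹ := fun i => hA ▸ (b1 i).2.2.1
    have hψ1 : ∀ i, |pd3 i ψ x| ≤ A * ρ⁻¹ := fun i => hA ▸ (b2 i).2.2.1
    have hφ2 : ∀ i, |pd3 i (pd3 i φ) x| ≤ B * ρ⁻¹ ^ 2 := fun i => (b1 i).2.2.2.trans hB2
    have hψ2 : ∀ i, |pd3 i (pd3 i ψ) x| ≤ B * ρ⁻¹ ^ 2 := fun i => (b2 i).2.2.2.trans hB2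
    refine ⟨?_, fun i => ?_, ?_⟩
    · rw [abs_mul]
      exact mul_le_one₀ hφ0 (abs_nonneg _) hψ0
    · rw [pd3_mul_eqOn isOpen_univ i (hφ.of_le one_le_two).contDiffOn
        (hψ.of_le one_le_two).contDiffOn (Set.mem_univ x)]
      refine (abs_add_le _ _).trans ?_
      rw [abs_mul, abs_mul]
      calc _ ≤ 1 * (A * ρ⁻¹) + 1 * (A * ρ⁻¹) := by
            gcongr
            · exact hψ1 i
            · exact hφ1 i
        _ = 2 * A * ρ⁻¹ := by ring
        _ ≤ _ := by gcongr; nlinarith [sq_nonneg A]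
    · have h2 : ∀ i, |pd3 i (pd3 i fun x => φ x * ψ x) x| ≤ (2 * A ^ 2 + 2 * B) * ρ⁻¹ ^ 2 := by
        intro i
        rw [pd3_pd3_mul_eqOn isOpen_univ i hφ.contDiffOn hψ.contDiffOn (Set.mem_univ x)]
        refine (abs_add_three _ _ _).trans ?_
        rw [abs_mul, abs_mul, abs_mul, abs_mul, abs_two]
        calc _ ≤ 1 * (B * ρ⁻¹ ^ 2) + 2 * ((A * ρ⁻¹) * (A * ρ⁻¹)) + 1 * (B * ρ⁻¹ ^ 2) := by
              gcongr
              · exact hψ2 i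
              · exact hφ1 i
              · exact hψ1 i
              · exact hφ2 i
          _ = _ := by ring
      refine (abs_add_three _ _ _).trans ?_
      have hp : 0 ≤ A * ρ⁻¹ ^ 2 := by positivity
      linarith [h2 0, h2 1, h2 2]

/-- The edge a priori estimate transported to dilated wedges. -/
theorem EdgeAPrioriK.dilate {a b β ε : ℝ} (hAP : EdgeAPrioriK a b β ε) :
    ∃ C₀ : ℝ, 0 < C₀ ∧ ∀ s : ℝ, 1 ≤ s → ∀ g : ℂ × ℝ → ℝ,
      ContDiffOn ℝ 2 g (closure (Wdom a b (s * (1 + ε) - 1)) \ EdgeSet) →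
      wMemK β 2 (Wdom a b (s - 1)) g →
      wMemK (β + 1) 1 (Wdom a b (s * (1 + ε) - 1)) g →
      wDirBC a b (s * (1 + ε) - 1) g →
      wMemK (β + 2) 0 (Wdom a b (s * (1 + ε) - 1)) (lap3 g) →
      wKnorm β 2 (Wdom a b (s - 1)) g ≤
        C₀ * (wKnorm (β + 2) 0 (Wdom a b (s * (1 + ε) - 1)) (lap3 g) +
          wKnorm (β + 1) 1 (Wdom a b (s * (1 + ε) - 1)) g) := by
  obtain ⟨C₀, hC₀, H⟩ := hAP
  refine ⟨C₀, hC₀, fun s hs1 g hg h2 h1 hbc h0 => ?_⟩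
  have hs : 0 < s := by linarith
  have hW (δ : ℝ) : MeasurableSet (Wdom a b δ) := (isOpen_Wdom a b δ).measurableSet
  have e0 : s • Wdom a b 0 = Wdom a b (s - 1) := by rw [smul_Wdom hs]; congr 1; ring
  have eε : s • Wdom a b ε = Wdom a b (s * (1 + ε) - 1) := smul_Wdom hs
  rw [← e0] at h2 ⊢
  have h := H (fun x => g (s • x)) (lap3 fun x => g (s • x)) ?_ (h2.comp_smul hs (hW _)) ?_
    (fun _ _ => rfl) ?_ ?_
  · rw [wKnorm_comp_smul hs, wKnorm_comp_smul hs, lap3_comp_smul,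
      wKnorm_zero_const_mul (sq_nonneg s), wKnorm_comp_smul hs (g := lap3 g), eε,
      Real.rpow_add_one hs.ne', show β + 2 = β + (2 : ℕ) by norm_num,
      Real.rpow_add_natCast hs.ne'] at h
    push_cast at h
    set P := wKnorm β 2 (s • Wdom a b 0) g
    set N0 := wKnorm (β + 2) 0 (Wdom a b (s * (1 + ε) - 1)) (lap3 g)
    set N1 := wKnorm (β + 1) 1 (Wdom a b (s * (1 + ε) - 1)) g
    have hN1 : 0 ≤ N1 := wKnorm_nonneg _ _ _ _
    have hsβ : 0 < s ^ β := Real.rpow_pos_of_pos hs β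
    have hκ : 0 < (s ^ β)⁻¹ * √(s ^ 3)⁻¹ := by positivity
    refine le_of_mul_le_mul_left (h.trans ?_) hκ
    have e : C₀ * (s ^ 2 * ((s ^ β * s ^ 2)⁻¹ * √(s ^ 3)⁻¹ * N0) +
        (s ^ β * s)⁻¹ * √(s ^ 3)⁻¹ * N1) =
        (s ^ β)⁻¹ * √(s ^ 3)⁻¹ * (C₀ * (N0 + s⁻¹ * N1)) := by
      field_simp
    rw [e]
    gcongr
    exact mul_le_of_le_one_left hN1 (inv_le_one_of_one_le₀ hs1)
  · refine hg.comp (contDiff_const_smul s).contDiffOn fun x hx => ?_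
    refine ⟨smul_mem_closure_Wdom hs hx.1, fun hc => hx.2 ?_⟩
    simpa [EdgeSet, hs.ne'] using hc
  · rw [← eε] at h1
    exact h1.comp_smul hs (hW _)
  · exact fun x hx => hbc _ ⟨smul_mem_Faces hs hx.1, smul_mem_closure_Wdom hs hx.2⟩
  · rw [lap3_comp_smul]
    rw [← eε] at h0
    exact (h0.comp_smul hs (hW _)).const_mul
theorem integrableOn_and_setIntegral_le {V V' : Set (ℂ × ℝ)} (hV : IsOpen V) (hV' : IsOpen V')
    (hVV' : V ⊆ V') {F G : ℂ × ℝ → ℝ} (hF : ContinuousOn F V) (hF0 : ∀ x ∈ V, 0 ≤ F x)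
    (hFG : ∀ x ∈ V, F x ≤ G x) (hG : IntegrableOn G V) (hz : ∀ x ∈ V' \ V, F x = 0) :
    IntegrableOn F V' ∧ ∫ x in V', F x ≤ ∫ x in V, G x := by
  have hi : IntegrableOn F V := by
    refine Integrable.mono' hG (hF.aestronglyMeasurable hV.measurableSet) ?_
    refine (ae_restrict_iff' hV.measurableSet).2 (Filter.Eventually.of_forall fun x hx => ?_)
    rw [Real.norm_of_nonneg (hF0 x hx)]
    exact hFG x hx
  refine ⟨hi.of_forall_sdiff_eq_zero hV'.measurableSet hz, ?_⟩
  rw [setIntegral_eq_of_subset_of_forall_sdiff_eq_zero hV'.measurableSet hVV' hz]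
  exact setIntegral_mono_on hi hG hV.measurableSet hFG

theorem continuousOn_weight (a b ε γ : ℝ) :
    ContinuousOn (fun x : ℂ × ℝ => ‖x.1‖ ^ γ) (Wdom a b ε) :=
  (by fun_prop : Continuous fun x : ℂ × ℝ => ‖x.1‖).continuousOn.rpow_const
    fun _ hx => Or.inl (norm_ne_zero_iff.2 (fst_ne_zero_of_mem_Wdom hx))

theorem pd3_zero (i : Fin 3) : pd3 i (fun _ => 0) = fun _ => 0 := by
  funext x
  simp [pd3]

theorem cutoff_mul_vanish (χ u : ℂ × ℝ → ℝ) {x : ℂ × ℝ} (hx : x ∉ tsupport χ) :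
    χ x * u x = 0 ∧ (∀ i, pd3 i (fun x => χ x * u x) x = 0) ∧
      lap3 (fun x => χ x * u x) x = 0 := by
  have hU : IsOpen (tsupport χ)ᶜ := (isClosed_tsupport χ).isOpen_compl
  have h : Set.EqOn (fun x => χ x * u x) (fun _ => 0) (tsupport χ)ᶜ := fun y hy => by
    simp [image_eq_zero_of_notMem_tsupport hy]
  refine ⟨h hx, fun i => ?_, ?_⟩
  · rw [pd3_eqOn hU i h hx, pd3_zero]
  · rw [lap3_eqOn hU h hx]
    simp [lap3, pd3_zero]

theorem contDiffOn_cutoff_mul {a b δ ε : ℝ} {χ u : ℂ × ℝ → ℝ} (hχ : ContDiff ℝ 2 χ)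
    (hsupp : tsupport χ ⊆ Cyl δ) (hu : ContDiffOn ℝ 2 u (closure (Wdom a b δ) \ EdgeSet)) :
    ContDiffOn ℝ 2 (fun x => χ x * u x) (closure (Wdom a b ε) \ EdgeSet) := by
  intro x hx
  by_cases hxC : x ∈ Cyl δ
  · have hn : Cyl δ ∈ nhds x := (isOpen_Cyl δ).mem_nhds hxC
    have hsub : (closure (Wdom a b ε) \ EdgeSet) ∩ Cyl δ ⊆ closure (Wdom a b δ) \ EdgeSet :=
      fun y hy => ⟨closure_Wdom_inter_Cyl_subset a b δ ε ⟨hy.1.1, hy.2⟩, hy.1.2⟩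
    rw [← contDiffWithinAt_inter hn]
    exact (hχ.contDiffOn.mul hu).mono hsub x ⟨hx, hxC⟩
  · have hx' : x ∉ tsupport χ := fun h => hxC (hsupp h)
    have h0 : (fun x => χ x * u x) =ᶠ[nhds x] fun _ => 0 := by
      filter_upwards [(isClosed_tsupport χ).isOpen_compl.mem_nhds hx'] with y hy
      exact (cutoff_mul_vanish χ u hy).1
    exact (contDiffAt_const.congr_of_eventuallyEq h0).contDiffWithinAt

theorem contDiffOn_Wdom {a b δ : ℝ} {u : ℂ × ℝ → ℝ}
    (hu : ContDiffOn ℝ 2 u (closure (Wdom a b δ) \ EdgeSet)) : ContDiffOn ℝ 2 u (Wdom a b δ) :=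
  hu.mono fun _ hx => ⟨subset_closure hx, fst_ne_zero_of_mem_Wdom hx⟩

theorem notMem_tsupport_of_mem_diff {a b δ ε : ℝ} {χ : ℂ × ℝ → ℝ} (hsupp : tsupport χ ⊆ Cyl δ)
    {x : ℂ × ℝ} (hx : x ∈ Wdom a b ε \ Wdom a b δ) : x ∉ tsupport χ :=
  fun h => hx.2 (mem_Wdom.2 ⟨(mem_Wdom.1 hx.1).1, hsupp h⟩)

/-- The Laplacian of the truncated function in terms of the data of the original one. -/
theorem lap3_cutoff_mul_bound {a b γ δ ε K k : ℝ} (hδ : δ ≤ ε) (hK : 0 ≤ K) (hk : 0 ≤ k)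
    {χ u f : ℂ × ℝ → ℝ} (hχ : ContDiff ℝ 2 χ) (hsupp : tsupport χ ⊆ Cyl δ)
    (hχ0 : ∀ x ∈ Cyl δ, |χ x| ≤ 1) (hχ1 : ∀ x ∈ Cyl δ, ∀ i, |pd3 i χ x| ≤ K * k)
    (hχ2 : ∀ x ∈ Cyl δ, |lap3 χ x| ≤ K * k ^ 2) (hu : ContDiffOn ℝ 2 u (Wdom a b δ))
    (hf : ∀ x ∈ Wdom a b δ, lap3 u x = f x) (hu1 : wMemK γ 1 (Wdom a b δ) u)
    (hu0 : wMemK (γ + 1) 0 (Wdom a b δ) u) (hfm : wMemK (γ + 1) 0 (Wdom a b δ) f) :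
    wMemK (γ + 1) 0 (Wdom a b ε) (lap3 fun x => χ x * u x) ∧
      wKnorm (γ + 1) 0 (Wdom a b ε) (lap3 fun x => χ x * u x) ≤
        (3 + 5 * K) * (wKnorm (γ + 1) 0 (Wdom a b δ) f + k * wKnorm γ 1 (Wdom a b δ) u +
          k ^ 2 * wKnorm (γ + 1) 0 (Wdom a b δ) u) := by
  have hW (δ : ℝ) := isOpen_Wdom a b δ
  rw [wMemK_zero_iff] at hu0 hfm ⊢
  have hu1' := (wMemK_one_iff.1 hu1).2
  set F : ℂ × ℝ → ℝ := fun x => (‖x.1‖ ^ (γ + 1) * lap3 (fun x => χ x * u x) x) ^ 2 with hFdef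
  set G : ℂ × ℝ → ℝ := fun x => 5 * (‖x.1‖ ^ (γ + 1) * f x) ^ 2 +
    20 * (K * k) ^ 2 * ∑ i, (‖x.1‖ ^ (γ + 1) * pd3 i u x) ^ 2 +
      5 * (K * k ^ 2) ^ 2 * (‖x.1‖ ^ (γ + 1) * u x) ^ 2 with hGdef
  have hGs : IntegrableOn (fun x => ∑ i, (‖x.1‖ ^ (γ + 1) * pd3 i u x) ^ 2) (Wdom a b δ) :=
    integrable_finsetSum _ fun i _ => hu1' i
  have hG1 := Integrable.const_mul hfm 5
  have hG2 := Integrable.const_mul hGs (20 * (K * k) ^ 2)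
  have hG3 := Integrable.const_mul hu0 (5 * (K * k ^ 2) ^ 2)
  have hG12 : IntegrableOn (fun x => 5 * (‖x.1‖ ^ (γ + 1) * f x) ^ 2 +
      20 * (K * k) ^ 2 * ∑ i, (‖x.1‖ ^ (γ + 1) * pd3 i u x) ^ 2) (Wdom a b δ) := hG1.add hG2
  have hG : IntegrableOn G (Wdom a b δ) := hG12.add hG3
  have hFG : ∀ x ∈ Wdom a b δ, F x ≤ G x := by
    intro x hx
    have hxC := (mem_Wdom.1 hx).2
    have hsq {y z B : ℝ} (hy : |y| ≤ B) : (y * z) ^ 2 ≤ B ^ 2 * z ^ 2 := by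
      rw [mul_pow, ← sq_abs y]
      gcongr
    have t0 := hsq (z := f x) (hχ0 x hxC)
    have t1 := fun i => hsq (z := pd3 i u x) (hχ1 x hxC i)
    have t2 := hsq (z := u x) (hχ2 x hxC)
    have hl : (lap3 (fun x => χ x * u x) x) ^ 2 ≤ 5 * f x ^ 2 +
        20 * (K * k) ^ 2 * ∑ i, pd3 i u x ^ 2 + 5 * (K * k ^ 2) ^ 2 * u x ^ 2 := by
      rw [lap3_mul_eqOn (hW δ) hχ.contDiffOn hu hx]
      simp only [Fin.sum_univ_three, hf x hx]
      have h5 (p q r s t : ℝ) : (p + 2 * (q + r + s) + t) ^ 2 ≤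
          5 * p ^ 2 + 20 * (q ^ 2 + r ^ 2 + s ^ 2) + 5 * t ^ 2 := by
        nlinarith [sq_nonneg (p - 2 * q), sq_nonneg (p - 2 * r), sq_nonneg (p - 2 * s),
          sq_nonneg (p - t), sq_nonneg (q - r), sq_nonneg (q - s), sq_nonneg (r - s),
          sq_nonneg (2 * q - t), sq_nonneg (2 * r - t), sq_nonneg (2 * s - t)]
      refine (h5 _ _ _ _ _).trans ?_
      have t10 := t1 0
      have t11 := t1 1
      have t12 := t1 2
      rw [mul_comm (u x)]
      linarith
    have hr : 0 ≤ (‖x.1‖ ^ (γ + 1)) ^ 2 := sq_nonneg _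
    calc F x = (‖x.1‖ ^ (γ + 1)) ^ 2 * (lap3 (fun x => χ x * u x) x) ^ 2 := mul_pow _ _ _
      _ ≤ _ := mul_le_mul_of_nonneg_left hl hr
      _ = G x := by simp only [hGdef, Fin.sum_univ_three]; ring
  have hFc : ContinuousOn F (Wdom a b δ) :=
    ((continuousOn_weight a b δ _).mul (continuousOn_lap3 (hW δ) (hχ.contDiffOn.mul hu))).pow 2
  obtain ⟨h1, h2⟩ := integrableOn_and_setIntegral_le (hW δ) (hW ε) (Wdom_mono hδ) hFc
    (fun _ _ => sq_nonneg _) hFG hG fun x hx => by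
      simp [hFdef, (cutoff_mul_vanish χ u (notMem_tsupport_of_mem_diff hsupp hx)).2.2]
  refine ⟨h1, ?_⟩
  have hGint : ∫ x in Wdom a b δ, G x = 5 * wKnorm (γ + 1) 0 (Wdom a b δ) f ^ 2 +
      20 * (K * k) ^ 2 * (∑ i, ∫ x in Wdom a b δ, (‖x.1‖ ^ (γ + 1) * pd3 i u x) ^ 2) +
      5 * (K * k ^ 2) ^ 2 * wKnorm (γ + 1) 0 (Wdom a b δ) u ^ 2 := by
    rw [wKnorm_zero_sq, wKnorm_zero_sq, ← integral_finsetSum _ fun i _ => hu1' i,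
      ← integral_const_mul, ← integral_const_mul, ← integral_const_mul,
      ← integral_add hG1 hG2, ← integral_add hG12 hG3]
  have hB := wKnorm_one_sq γ (Wdom a b δ) u
  have hE : 0 ≤ ∫ x in Wdom a b δ, (‖x.1‖ ^ γ * u x) ^ 2 := integral_nonneg fun _ => sq_nonneg _
  have hA0 := wKnorm_nonneg (γ + 1) 0 (Wdom a b δ) f
  have hB0 := wKnorm_nonneg γ 1 (Wdom a b δ) u
  have hD0 := wKnorm_nonneg (γ + 1) 0 (Wdom a b δ) u
  rw [hGint] at h2
  set A := wKnorm (γ + 1) 0 (Wdom a b δ) f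
  set B := wKnorm γ 1 (Wdom a b δ) u
  set D := wKnorm (γ + 1) 0 (Wdom a b δ) u
  set S := ∑ i, ∫ x in Wdom a b δ, (‖x.1‖ ^ (γ + 1) * pd3 i u x) ^ 2
  have hSB : S ≤ B ^ 2 := by linarith
  refine le_of_sq_le_sq ?_ (by positivity)
  rw [wKnorm_zero_sq]
  have hkB : 0 ≤ k * B := by positivity
  have hkD : 0 ≤ k ^ 2 * D := by positivity
  have hX : A ^ 2 + (k * B) ^ 2 + (k ^ 2 * D) ^ 2 ≤ (A + k * B + k ^ 2 * D) ^ 2 := by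
    nlinarith [mul_nonneg hA0 hkB, mul_nonneg hA0 hkD, mul_nonneg hkB hkD]
  calc _ ≤ _ := h2
    _ ≤ 5 * A ^ 2 + 20 * (K * k) ^ 2 * B ^ 2 + 5 * (K * k ^ 2) ^ 2 * D ^ 2 := by gcongr
    _ ≤ (5 + 20 * K ^ 2) * (A ^ 2 + (k * B) ^ 2 + (k ^ 2 * D) ^ 2) := by
      have p1 : 0 ≤ K ^ 2 * A ^ 2 := by positivity
      have p2 : 0 ≤ (k * B) ^ 2 := by positivity
      have p3 : 0 ≤ (k ^ 2 * D) ^ 2 := by positivity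
      have p4 : 0 ≤ K ^ 2 * (k ^ 2 * D) ^ 2 := by positivity
      linarith
    _ ≤ (3 + 5 * K) ^ 2 * (A + k * B + k ^ 2 * D) ^ 2 := by
      gcongr
      nlinarith
    _ = _ := by ring

/-- The first order norm of the truncated function in terms of the original one. -/
theorem cutoff_mul_bound {a b γ δ ε K k E : ℝ} (hδ : δ ≤ ε) (hK : 0 ≤ K) (hk : 0 ≤ k)
    (hE : 1 ≤ E * k)
    {χ u : ℂ × ℝ → ℝ} (hχ : ContDiff ℝ 2 χ) (hsupp : tsupport χ ⊆ Cyl δ)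
    (hχ0 : ∀ x ∈ Cyl δ, |χ x| ≤ 1) (hχ1 : ∀ x ∈ Cyl δ, ∀ i, |pd3 i χ x| ≤ K * k)
    (hu : ContDiffOn ℝ 2 u (Wdom a b δ)) (hu1 : wMemK γ 1 (Wdom a b δ) u)
    (hu0 : wMemK (γ + 1) 0 (Wdom a b δ) u) :
    wMemK γ 1 (Wdom a b ε) (fun x => χ x * u x) ∧
      wKnorm γ 1 (Wdom a b ε) (fun x => χ x * u x) ≤
        (2 + 3 * K) * E * (k * wKnorm γ 1 (Wdom a b δ) u +
          k ^ 2 * wKnorm (γ + 1) 0 (Wdom a b δ) u) := by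
  have hW (δ : ℝ) := isOpen_Wdom a b δ
  rw [wMemK_zero_iff] at hu0
  obtain ⟨hu10, hu11⟩ := wMemK_one_iff.1 hu1
  have hχ' : ContDiffOn ℝ 1 χ (Wdom a b δ) := (hχ.of_le one_le_two).contDiffOn
  have hu' : ContDiffOn ℝ 1 u (Wdom a b δ) := hu.of_le one_le_two
  have hsq {y z B : ℝ} (hy : |y| ≤ B) : (y * z) ^ 2 ≤ B ^ 2 * z ^ 2 := by
    rw [mul_pow, ← sq_abs y]
    gcongr
  obtain ⟨h1, h2⟩ := integrableOn_and_setIntegral_le (hW δ) (hW ε) (Wdom_mono hδ)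
    (F := fun x => (‖x.1‖ ^ γ * (χ x * u x)) ^ 2) (G := fun x => (‖x.1‖ ^ γ * u x) ^ 2)
    (((continuousOn_weight a b δ _).mul (hχ'.mul hu').continuousOn).pow 2)
    (fun _ _ => sq_nonneg _)
    (fun x hx => by
      have := hsq (z := u x) (hχ0 x (mem_Wdom.1 hx).2)
      rw [one_pow, one_mul] at this
      rw [mul_pow, mul_pow (‖x.1‖ ^ γ)]
      exact mul_le_mul_of_nonneg_left this (sq_nonneg _)) hu10
    (fun x hx => by
      simp [(cutoff_mul_vanish χ u (notMem_tsupport_of_mem_diff hsupp hx)).1])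
  have hG (i : Fin 3) : IntegrableOn (fun x => 2 * (‖x.1‖ ^ (γ + 1) * pd3 i u x) ^ 2 +
      2 * (K * k) ^ 2 * (‖x.1‖ ^ (γ + 1) * u x) ^ 2) (Wdom a b δ) :=
    Integrable.add ((hu11 i).const_mul 2) (Integrable.const_mul hu0 (2 * (K * k) ^ 2))
  have hd (i : Fin 3) := by
    refine integrableOn_and_setIntegral_le (hW δ) (hW ε) (Wdom_mono hδ)
      (F := fun x => (‖x.1‖ ^ (γ + 1) * pd3 i (fun x => χ x * u x) x) ^ 2)
      (G := fun x => 2 * (‖x.1‖ ^ (γ + 1) * pd3 i u x) ^ 2 +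
        2 * (K * k) ^ 2 * (‖x.1‖ ^ (γ + 1) * u x) ^ 2)
      (((continuousOn_weight a b δ _).mul (contDiffOn_pd3 (n := 0) (hW δ) i
        (by simpa using hχ'.mul hu')).continuousOn).pow 2)
      (fun _ _ => sq_nonneg _) (fun x hx => ?_) (hG i)
      (fun x hx => by
        simp [(cutoff_mul_vanish χ u (notMem_tsupport_of_mem_diff hsupp hx)).2.1])
    have t0 := hsq (z := pd3 i u x) (hχ0 x (mem_Wdom.1 hx).2)
    have t1 := hsq (z := u x) (hχ1 x (mem_Wdom.1 hx).2 i)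
    have hr : 0 ≤ (‖x.1‖ ^ (γ + 1)) ^ 2 := sq_nonneg _
    have hl : pd3 i (fun x => χ x * u x) x ^ 2 ≤
        2 * pd3 i u x ^ 2 + 2 * (K * k) ^ 2 * u x ^ 2 := by
      rw [pd3_mul_eqOn (hW δ) i hχ' hu' hx]
      simp only [mul_comm (u x)]
      nlinarith [sq_nonneg (χ x * pd3 i u x - pd3 i χ x * u x)]
    calc _ = (‖x.1‖ ^ (γ + 1)) ^ 2 * pd3 i (fun x => χ x * u x) x ^ 2 := mul_pow _ _ _
      _ ≤ _ := mul_le_mul_of_nonneg_left hl hr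
      _ = _ := by ring
  refine ⟨wMemK_one_iff.2 ⟨h1, fun i => (hd i).1⟩, ?_⟩
  have hd' (i : Fin 3) := (hd i).2
  simp only [integral_add (Integrable.const_mul (hu11 _) 2)
    (Integrable.const_mul hu0 (2 * (K * k) ^ 2)), integral_const_mul] at hd'
  have hB := wKnorm_one_sq γ (Wdom a b δ) u
  have hD := wKnorm_zero_sq (γ + 1) (Wdom a b δ) u
  have hI : 0 ≤ ∫ x in Wdom a b δ, (‖x.1‖ ^ γ * u x) ^ 2 := integral_nonneg fun _ => sq_nonneg _
  have hB0 := wKnorm_nonneg γ 1 (Wdom a b δ) u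
  have hD0 := wKnorm_nonneg (γ + 1) 0 (Wdom a b δ) u
  have hE0 : 0 ≤ E := by
    by_contra! hc
    nlinarith [mul_nonneg hk (neg_pos.2 hc).le]
  rw [← hD] at hd'
  refine le_of_sq_le_sq ?_ (by positivity)
  rw [wKnorm_one_sq]
  have hS := Finset.sum_le_sum fun i (_ : i ∈ Finset.univ) => hd' i
  rw [Finset.sum_add_distrib, ← Finset.mul_sum, Finset.sum_const, Finset.card_univ,
    Fintype.card_fin, nsmul_eq_mul] at hS
  push_cast at hS
  set B := wKnorm γ 1 (Wdom a b δ) u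
  set D := wKnorm (γ + 1) 0 (Wdom a b δ) u
  have hkB : 0 ≤ k * B := by positivity
  have hkD : 0 ≤ k ^ 2 * D := by positivity
  calc _ ≤ 2 * B ^ 2 + 6 * K ^ 2 * (k * D) ^ 2 := by linarith
    _ ≤ (E * k) ^ 2 * (2 * B ^ 2 + 6 * K ^ 2 * (k * D) ^ 2) :=
      le_mul_of_one_le_left (by positivity) (one_le_pow₀ hE)
    _ = E ^ 2 * (2 * (k * B) ^ 2 + 6 * K ^ 2 * (k ^ 2 * D) ^ 2) := by ring
    _ ≤ E ^ 2 * ((2 + 3 * K) ^ 2 * (k * B + k ^ 2 * D) ^ 2) := by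
      gcongr
      have p1 : 0 ≤ K * (k * B) ^ 2 := by positivity
      have p2 : 0 ≤ K ^ 2 * (k * B) ^ 2 := by positivity
      have p3 : 0 ≤ K ^ 2 * (k ^ 2 * D) ^ 2 := by positivity
      have p4 : 0 ≤ K * (k ^ 2 * D) ^ 2 := by positivity
      have p5 : 0 ≤ (2 + 3 * K) ^ 2 * (2 * ((k * B) * (k ^ 2 * D))) := by positivity
      nlinarith [sq_nonneg (k * B), sq_nonneg (k ^ 2 * D)]
    _ = _ := by ring

/-- **The ρ-estimate in a dihedral domain (Lemma on nested truncated wedges).** -/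
theorem wedge_rho_estimate
    (a b β ε : ℝ) (hab : a < b) (hω : b - a ≤ 2 * Real.pi) (hε : 0 < ε)
    (hAP : EdgeAPrioriK a b β ε) :
    ∃ C : ℝ, 0 < C ∧ ∀ R ρ : ℝ, 0 ≤ R → R < ε → 0 < ρ → ρ ≤ ε - R →
      ∀ u f : ℂ × ℝ → ℝ,
        ContDiffOn ℝ 2 u (closure (Wdom a b (R + ρ)) \ EdgeSet) →
        wMemK β 2 (Wdom a b (R + ρ)) u →
        (∀ x ∈ Wdom a b (R + ρ), lap3 u x = f x) →
        wDirBC a b (R + ρ) u →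
        wMemK (β + 2) 0 (Wdom a b (R + ρ)) f →
        wKnorm β 2 (Wdom a b R) u ≤
          C * (wKnorm (β + 2) 0 (Wdom a b (R + ρ)) f +
            ρ⁻¹ * wKnorm (β + 1) 1 (Wdom a b (R + ρ)) u +
            ρ⁻¹ ^ 2 * wKnorm (β + 2) 0 (Wdom a b (R + ρ)) u) := by
  obtain ⟨C₀, hC₀, H⟩ := hAP.dilate
  obtain ⟨K, hK, hcut⟩ := exists_cylinder_cutoff ε
  refine ⟨C₀ * (3 + 5 * K + (2 + 3 * K) * ε), by positivity, ?_⟩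
  intro R ρ hR hRε hρ hρε u f hu hu2 hlap hbc hf
  obtain ⟨χ, hχ, hχR, hsupp, hb⟩ := hcut R ρ hR hρ (by linarith)
  have hδ : R + ρ ≤ (1 + R) * (1 + ε) - 1 := by nlinarith [mul_nonneg hR hε.le]
  have hk : 0 ≤ ρ⁻¹ := by positivity
  have hone : 1 ≤ ε * ρ⁻¹ := by
    rw [← div_eq_mul_inv, one_le_div hρ]
    linarith
  have huW := contDiffOn_Wdom hu
  have h2 : β + 2 = β + 1 + 1 := by ring
  have hu10 : wMemK β 1 (Wdom a b (R + ρ)) u := fun k hk => hu2 k (hk.trans one_le_two)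
  have hu11 : wMemK (β + 1) 1 (Wdom a b (R + ρ)) u := fun k hk α hα => by
    have := integrableOn_weight_add_one (hu10 k hk α hα)
    rwa [add_right_comm] at this
  have hu00 : wMemK (β + 1 + 1) 0 (Wdom a b (R + ρ)) u :=
    wMemK_zero_iff.2 (integrableOn_weight_add_one (wMemK_one_iff.1 hu11).1)
  rw [h2] at hf ⊢
  obtain ⟨m0, n0⟩ := lap3_cutoff_mul_bound hδ hK.le hk hχ hsupp (fun x hx => (hb x hx).1)
    (fun x hx => (hb x hx).2.1) (fun x hx => (hb x hx).2.2) huW hlap hu11 hu00 hf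
  obtain ⟨m1, n1⟩ := cutoff_mul_bound hδ hK.le hk hone hχ hsupp (fun x hx => (hb x hx).1)
    (fun x hx => (hb x hx).2.1) huW hu11 hu00
  have heq : Set.EqOn u (fun x => χ x * u x) (Wdom a b R) := fun x hx => by
    simp [hχR x (mem_Wdom.1 hx).2]
  have hWR := isOpen_Wdom a b R
  have hs := H (1 + R) (by linarith) (fun x => χ x * u x) (contDiffOn_cutoff_mul hχ hsupp hu)
    (by
      rw [add_sub_cancel_left]
      exact (hu2.mono_set (Wdom_mono (by linarith))).congr_of_isOpen hWR heq)
    m1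
    (fun x hx => by
      by_cases hxC : x ∈ Cyl (R + ρ)
      · simp [hbc x ⟨hx.1, closure_Wdom_inter_Cyl_subset _ _ _ _ ⟨hx.2, hxC⟩⟩]
      · exact (cutoff_mul_vanish χ u fun h => hxC (hsupp h)).1)
    (by rw [h2]; exact m0)
  rw [add_sub_cancel_left, ← wKnorm_congr_of_isOpen β 2 hWR heq, h2] at hs
  have hA0 := wKnorm_nonneg (β + 1 + 1) 0 (Wdom a b (R + ρ)) f
  set A := wKnorm (β + 1 + 1) 0 (Wdom a b (R + ρ)) f
  set B := wKnorm (β + 1) 1 (Wdom a b (R + ρ)) u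
  set D := wKnorm (β + 1 + 1) 0 (Wdom a b (R + ρ)) u
  calc _ ≤ _ := hs
    _ ≤ C₀ * ((3 + 5 * K) * (A + ρ⁻¹ * B + ρ⁻¹ ^ 2 * D) +
        (2 + 3 * K) * ε * (ρ⁻¹ * B + ρ⁻¹ ^ 2 * D)) := by gcongr
    _ ≤ C₀ * ((3 + 5 * K) * (A + ρ⁻¹ * B + ρ⁻¹ ^ 2 * D) +
        (2 + 3 * K) * ε * (A + ρ⁻¹ * B + ρ⁻¹ ^ 2 * D)) := by
      gcongr
      linarith
    _ = _ := by ring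
end
end
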